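/- Let G be a discrete group and let Λ ⊆ G \ {1} be a symmetric set (Λ⁻¹ = Λ) which is completely Sidon (with some constant C). Then every bounded Hermitian function φ : Λ → ℂ (meaning φ(t⁻¹) = conj(φ(t)) for all t ∈ Λ, and sup_{t∈Λ}|φ(t)| < ∞) admits an extension φ̃ : G → ℂ which is positive definite on G, i.e. φ̃(t) = φ(t) for all t ∈ Λ and for every n, every t : Fin n → G, the matrix (φ̃((t i)⁻¹ * (t j)))_{i,j} is positive semidefinite. -/

import Mathlib

/-- The operator `Op(a,v)` on the ℓ²-direct sum of `N` copies of `H`. -/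
noncomputable def sidonOp {G : Type} {Λ : Set G} {N : ℕ}
    (a : ↥Λ →₀ Matrix (Fin N) (Fin N) ℂ)
    {H : Type} [NormedAddCommGroup H] [InnerProductSpace ℂ H]
    (v : ↥Λ → H →L[ℂ] H) :
    PiLp 2 (fun _ : Fin N => H) →L[ℂ] PiLp 2 (fun _ : Fin N => H) :=
  (((PiLp.continuousLinearEquiv 2 ℂ (fun _ : Fin N => H)).symm :
      (Fin N → H) →L[ℂ] PiLp 2 (fun _ : Fin N => H)).comp
    ((ContinuousLinearMap.pi fun i =>
        ∑ t ∈ a.support, ∑ j, (a t i j) • ((v t).comp (ContinuousLinearMap.proj j))).comp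
      (((PiLp.continuousLinearEquiv 2 ℂ (fun _ : Fin N => H)) :
        PiLp 2 (fun _ : Fin N => H) →L[ℂ] (Fin N → H)))))

/-- `Λ ⊆ G` is completely Sidon with constant `C`. -/
def IsCompletelySidon {G : Type} [Group G] (Λ : Set G) (C : ℝ) : Prop :=
  ∀ (N : ℕ) (a : ↥Λ →₀ Matrix (Fin N) (Fin N) ℂ) (D : ℝ), 0 ≤ D →
    (∀ (H' : Type) [NormedAddCommGroup H'] [InnerProductSpace ℂ H'] [CompleteSpace H']
        (π : G →* unitary (H' →L[ℂ] H')),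
        ‖sidonOp a (fun t => ((π (t : G) : unitary (H' →L[ℂ] H')) : H' →L[ℂ] H'))‖ ≤ D) →
    ∀ (K : Type) [NormedAddCommGroup K] [InnerProductSpace ℂ K] [CompleteSpace K]
      (u : ↥Λ → unitary (K →L[ℂ] K)),
      ‖sidonOp a (fun t => ((u t : unitary (K →L[ℂ] K)) : K →L[ℂ] K))‖ ≤ C * D
open scoped ComplexOrder in
/-- A complex-valued function on a group is positive definite. -/
def IsPosDefFn {G : Type} [Group G] (f : G → ℂ) : Prop :=
  ∀ (n : ℕ) (t : Fin n → G),
    (Matrix.of fun i j : Fin n => f ((t i)⁻¹ * t j)).PosSemidef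

namespace CSid
open scoped ComplexOrder ComplexConjugate
open Filter Topology

/-- positive semidefinite kernels -/
def KP {ι : Type*} (k : ι → ι → ℂ) : Prop := (Matrix.of k).PosSemidef

/-- positive definite functions -/
def PD {G : Type*} [Group G] (f : G → ℂ) : Prop := KP fun g h => f (g⁻¹ * h)

section
variable {ι κ : Type*} {k l : ι → ι → ℂ}

lemma KP.herm (h : KP k) (x y : ι) : conj (k y x) = k x y := by
  have := congrFun (congrFun h.1 x) y
  simpa using this

lemma KP.sum_nonneg (h : KP k) (s : Finset ι) (c : ι → ℂ) :
    0 ≤ ∑ x ∈ s, ∑ y ∈ s, conj (c x) * k x y * c y := by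
  classical
  have := h.2 (Finsupp.indicator s (fun x _ => c x))
  rw [Finsupp.sum_of_support_subset (s := s) _ (Finsupp.support_indicator_subset _ _)
    _ (by simp)] at this
  refine this.trans_eq (Finset.sum_congr rfl fun x hx => ?_)
  rw [Finsupp.sum_of_support_subset (s := s) _ (Finsupp.support_indicator_subset _ _)
    _ (by simp)]
  refine Finset.sum_congr rfl fun y hy => ?_
  simp [Finsupp.indicator_apply, hx, hy]

lemma KP.mk (hh : ∀ x y, conj (k y x) = k x y)
    (h : ∀ (s : Finset ι) (c : ι → ℂ), 0 ≤ ∑ x ∈ s, ∑ y ∈ s, conj (c x) * k x y * c y) : KP k := by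
  refine ⟨?_, fun x => ?_⟩
  · ext i j; simpa using hh i j
  · simpa [Finsupp.sum] using h x.support x

lemma KP.comp (h : KP k) (f : κ → ι) : KP fun x y => k (f x) (f y) :=
  Matrix.PosSemidef.submatrix h f

lemma KP.add (h : KP k) (h' : KP l) : KP fun x y => k x y + l x y :=
  Matrix.PosSemidef.add h h'

lemma KP.mul (h : KP k) (h' : KP l) : KP fun x y => k x y * l x y :=
  Matrix.PosSemidef.hadamard h h'

lemma KP.conj (h : KP k) : KP fun x y => conj (k x y) := by
  have := Matrix.PosSemidef.transpose h
  have e : (Matrix.of k).transpose = Matrix.of fun x y => (starRingEnd ℂ) (k x y) := by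
    ext i j; simp [h.herm]
  unfold KP
  rw [← e]; exact this

lemma KP.smul (h : KP k) {r : ℝ} (hr : 0 ≤ r) : KP fun x y => (r : ℂ) * k x y := by
  refine KP.mk (fun x y => by simp [h.herm]) fun s c => ?_
  have := h.sum_nonneg s c
  have h2 : ∑ x ∈ s, ∑ y ∈ s, (starRingEnd ℂ) (c x) * ((r : ℂ) * k x y) * c y
    = r * ∑ x ∈ s, ∑ y ∈ s, (starRingEnd ℂ) (c x) * k x y * c y := by
    simp only [Finset.mul_sum]
    refine Finset.sum_congr rfl fun x _ => Finset.sum_congr rfl fun y _ => by ring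
  rw [h2]
  exact mul_nonneg (by exact_mod_cast hr) this

lemma KP.zero : KP (fun _ _ : ι => (0 : ℂ)) := KP.mk (by simp) (by simp)

lemma KP.sum {α : Type*} (s : Finset α) {k : α → ι → ι → ℂ} (h : ∀ a ∈ s, KP (k a)) :
    KP fun x y => ∑ a ∈ s, k a x y := by
  classical
  induction s using Finset.induction_on with
  | empty => simpa using KP.zero
  | insert a s ha ih =>
    simp only [Finset.sum_insert ha]
    exact (h a (by simp)).add (ih fun b hb => h b (by simp [hb]))

lemma KP.rank1 (f : ι → ℂ) : KP fun x y => conj (f x) * f y := by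
  refine KP.mk (fun x y => by simp [mul_comm]) fun s c => ?_
  have : ∑ x ∈ s, ∑ y ∈ s, (starRingEnd ℂ) (c x) * ((starRingEnd ℂ) (f x) * f y) * c y
    = (starRingEnd ℂ) (∑ x ∈ s, f x * c x) * ∑ y ∈ s, f y * c y := by
    rw [map_sum, Finset.sum_mul_sum]
    refine Finset.sum_congr rfl fun x _ => Finset.sum_congr rfl fun y _ => by simp; ring
  rw [this]
  exact star_mul_self_nonneg _

lemma KP.one : KP fun _ _ : ι => (1 : ℂ) := by simpa using KP.rank1 (fun _ : ι => (1 : ℂ))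

lemma KP.gram {H : Type*} [NormedAddCommGroup H] [InnerProductSpace ℂ H] (e : ι → H) :
    KP fun x y => inner ℂ (e x) (e y) := by
  refine KP.mk (fun x y => by simp) fun s c => ?_
  have : ∑ x ∈ s, ∑ y ∈ s, (starRingEnd ℂ) (c x) * inner ℂ (e x) (e y) * c y
    = inner ℂ (∑ x ∈ s, c x • e x) (∑ y ∈ s, c y • e y) := by
    simp only [sum_inner, inner_sum, inner_smul_left, inner_smul_right]
    rw [Finset.sum_comm]
    refine Finset.sum_congr rfl fun x _ => ?_
    rw [Finset.mul_sum]
    exact Finset.sum_congr rfl fun y _ => by ring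
  rw [this, inner_self_eq_norm_sq_to_K]
  positivity

/-- equality-of-labels kernel -/
lemma KP.delta [DecidableEq κ] (f : ι → κ) : KP fun x y => if f x = f y then (1 : ℂ) else 0 := by
  have h : KP fun x y : κ => if x = y then (1 : ℂ) else 0 := by
    have : (1 : Matrix κ κ ℂ).PosSemidef := Matrix.PosSemidef.one
    unfold KP
    convert this using 1
    ext x y; simp [Matrix.one_apply]
  exact h.comp f

lemma KP.lim {α : Type*} {F : Filter α} [F.NeBot] {k : α → ι → ι → ℂ} {l : ι → ι → ℂ}
    (hl : ∀ x y, Tendsto (fun a => k a x y) F (𝓝 (l x y))) (h : ∀ᶠ a in F, KP (k a)) : KP l := by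
  refine KP.mk (fun x y => ?_) fun s c => ?_
  · have h1 : Tendsto (fun a => (starRingEnd ℂ) (k a y x)) F (𝓝 ((starRingEnd ℂ) (l y x))) :=
      (Complex.continuous_conj.tendsto _).comp (hl y x)
    refine tendsto_nhds_unique h1 ((hl x y).congr' ?_)
    filter_upwards [h] with a ha using (ha.herm x y).symm
  · have h1 : Tendsto (fun a => ∑ x ∈ s, ∑ y ∈ s, (starRingEnd ℂ) (c x) * k a x y * c y) F
      (𝓝 (∑ x ∈ s, ∑ y ∈ s, (starRingEnd ℂ) (c x) * l x y * c y)) :=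
      tendsto_finsetSum _ fun x _ => tendsto_finsetSum _ fun y _ =>
        ((hl x y).const_mul _).mul_const _
    refine isClosed_Ici.mem_of_tendsto h1 ?_
    filter_upwards [h] with a ha using ha.sum_nonneg s c

lemma KP.exists_gram {ι : Type} {k : ι → ι → ℂ} (h : KP k) :
    ∃ (H : Type) (_ : NormedAddCommGroup H) (_ : InnerProductSpace ℂ H) (_ : CompleteSpace H)
      (e : ι → H), ∀ x y, inner ℂ (e x) (e y) = k x y := by
  let K : Matrix ι ι (ℂ →L[ℂ] ℂ) := Matrix.of fun x y => k x y • ContinuousLinearMap.id ℂ ℂ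
  have hH : K.IsHermitian := by
    ext x y
    have h1 : star (ContinuousLinearMap.id ℂ ℂ) = ContinuousLinearMap.id ℂ ℂ :=
      star_one (ℂ →L[ℂ] ℂ)
    simp [K, ← h.herm x y, h1]
  have hK : K.PosSemidef := by
    refine ((RKHS.posSemidef_tfae (K := K)).out 0 2 rfl rfl).mpr ⟨hH, fun v => ?_⟩
    have := h.sum_nonneg v.support (fun x => v x)
    rw [Finset.sum_comm] at this
    have h2 := (Complex.le_def.1 this).1
    simp only [Finsupp.sum]
    refine h2.trans_eq ?_
    rw [← RCLike.conj_re]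
    simp only [map_sum]
    simp [K]
    rw [← Finset.sum_sub_distrib]
    refine Finset.sum_congr rfl fun x _ => ?_
    rw [← Finset.sum_sub_distrib]
    refine Finset.sum_congr rfl fun y _ => ?_
    ring
  have : Fact K.PosSemidef := ⟨hK⟩
  refine ⟨RKHS.OfKernel K, inferInstance, inferInstance, inferInstance,
    fun x => RKHS.kerFun (RKHS.OfKernel K) x 1, fun x y => ?_⟩
  have := RKHS.kernel_inner (RKHS.OfKernel K) x y (1:ℂ) (1:ℂ)
  rw [RKHS.OfKernel.kernel_ofKernel] at this
  rw [← inner_conj_symm]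
  simp only []
  rw [← this]
  simp [K]

lemma KP.diag_nonneg (h : KP k) (x : ι) : 0 ≤ (k x x).re ∧ ((k x x).re : ℂ) = k x x := by
  have : 0 ≤ k x x := Matrix.PosSemidef.diag_nonneg h (i := x)
  rw [Complex.le_def] at this
  refine ⟨this.1, ?_⟩
  apply Complex.ext <;> simp [← this.2]

lemma KP.norm_sq_le {ι : Type} {k : ι → ι → ℂ} (h : KP k) (x y : ι) :
    ‖k x y‖ ^ 2 ≤ (k x x).re * (k y y).re := by
  obtain ⟨H, _, _, _, e, he⟩ := h.exists_gram
  have h1 : ∀ z, (k z z).re = ‖e z‖ ^ 2 := fun z => by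
    rw [← he, inner_self_eq_norm_sq_to_K]; norm_cast
  rw [h1, h1, ← mul_pow, ← he]
  gcongr
  exact norm_inner_le_norm _ _
end

section
variable {G G' : Type*} [Group G] [Group G'] {f g : G → ℂ}

lemma PD.herm (h : PD f) (x : G) : conj (f x⁻¹) = f x := by
  have := KP.herm h 1 x
  simpa using this

lemma PD.kp (h : PD f) {ι : Type*} (t : ι → G) : KP fun i j => f ((t i)⁻¹ * t j) := KP.comp h t

lemma PD.comp (h : PD f) (q : G' →* G) : PD fun x => f (q x) := by
  unfold PD; simpa using h.kp q

lemma PD.add (h : PD f) (h' : PD g) : PD fun x => f x + g x := KP.add h h'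
lemma PD.mul (h : PD f) (h' : PD g) : PD fun x => f x * g x := KP.mul h h'
lemma PD.conj (h : PD f) : PD fun x => conj (f x) := KP.conj h
lemma PD.smul (h : PD f) {r : ℝ} (hr : 0 ≤ r) : PD fun x => (r : ℂ) * f x := KP.smul h hr
lemma PD.zero : PD (fun _ : G => (0 : ℂ)) := KP.zero
lemma PD.sum {α : Type*} (s : Finset α) {k : α → G → ℂ} (h : ∀ a ∈ s, PD (k a)) :
    PD fun x => ∑ a ∈ s, k a x := KP.sum s h

lemma PD.lim {α : Type*} {F : Filter α} [F.NeBot] {k : α → G → ℂ} {l : G → ℂ}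
    (hl : ∀ x, Tendsto (fun a => k a x) F (𝓝 (l x))) (h : ∀ᶠ a in F, PD (k a)) : PD l :=
  KP.lim (fun x y => hl (x⁻¹ * y)) h

lemma PD.one_nonneg (h : PD f) : 0 ≤ (f 1).re ∧ ((f 1).re : ℂ) = f 1 := by
  simpa using KP.diag_nonneg h 1

lemma PD.norm_le {G : Type} [Group G] {f : G → ℂ} (h : PD f) (x : G) : ‖f x‖ ≤ (f 1).re := by
  have := KP.norm_sq_le h 1 x
  simp at this
  rw [← sq] at this
  exact le_of_sq_le_sq this h.one_nonneg.1

/-- indicator of a subgroup -/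
lemma PD.ind (S : Subgroup G) [DecidablePred (· ∈ S)] : PD fun x => if x ∈ S then (1 : ℂ) else 0 := by
  classical
  have := KP.delta (fun x : G => (QuotientGroup.mk x : G ⧸ S))
  unfold PD
  convert this using 4
  exact QuotientGroup.eq.symm

lemma PD.delta_one [DecidableEq G] : PD fun x : G => if x = 1 then (1 : ℂ) else 0 := by
  classical
  have := PD.ind (⊥ : Subgroup G)
  convert this using 3
  exact Subgroup.mem_bot.symm

/-- characters -/
lemma PD.char (χ : G →* ℂ) (hχ : ∀ x, ‖χ x‖ = 1) : PD fun x => χ x := by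
  have h1 : ∀ x, (starRingEnd ℂ) (χ x) = χ x⁻¹ := fun x => by
    have h2 : χ x * χ x⁻¹ = 1 := by rw [← map_mul]; simp
    have h3 : χ x * (starRingEnd ℂ) (χ x) = 1 := by
      rw [Complex.mul_conj]; simp [Complex.normSq_eq_norm_sq, hχ]
    have h4 : χ x ≠ 0 := left_ne_zero_of_mul_eq_one h2
    exact mul_left_cancel₀ h4 (h3.trans h2.symm)
  have := KP.rank1 (fun x => χ x)
  unfold PD
  convert this using 4
  simp only [map_mul, h1]

end
end CSid

namespace CSid
open scoped ComplexOrder ComplexConjugate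
open Filter Topology

/-- bounded kernel gives bounded map on finite combos, blockwise -/
lemma block_bound {ι X H : Type} [Fintype ι] [NormedAddCommGroup H] [InnerProductSpace ℂ H]
    [DecidableEq X] [DecidableEq ι]
    (e : ι × X → H) (C : ℝ)
    (hb : ∀ i, KP fun x y : X => (C : ℂ) * (if x = y then 1 else 0) - inner ℂ (e (i,x)) (e (i,y)))
    (s : Finset (ι × X)) (c : ι × X → ℂ) :
    ‖∑ p ∈ s, c p • e p‖ ^ 2 ≤ Fintype.card ι * C * ∑ p ∈ s, ‖c p‖ ^ 2 := by
  have hblock : ∀ (i : ι) (t : Finset X), ‖∑ x ∈ t, c (i,x) • e (i,x)‖ ^ 2 ≤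
      C * ∑ x ∈ t, ‖c (i,x)‖ ^ 2 := by
    intro i t
    have h1 := (hb i).sum_nonneg t (fun x => c (i,x))
    have h2 : ∑ x ∈ t, ∑ y ∈ t, (starRingEnd ℂ) (c (i,x)) * ((C : ℂ) * (if x = y then 1 else 0) -
        inner ℂ (e (i,x)) (e (i,y))) * c (i,y) =
        (((C * ∑ x ∈ t, ‖c (i,x)‖ ^ 2) - ‖∑ x ∈ t, c (i,x) • e (i,x)‖ ^ 2 : ℝ) : ℂ) := by
      push_cast
      have := inner_self_eq_norm_sq_to_K (𝕜 := ℂ) (∑ x ∈ t, c (i,x) • e (i,x))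
      rw [show ((‖∑ x ∈ t, c (i,x) • e (i,x)‖ : ℝ) : ℂ) ^ 2 =
        inner ℂ (∑ x ∈ t, c (i,x) • e (i,x)) (∑ x ∈ t, c (i,x) • e (i,x)) from this.symm]
      simp only [sum_inner, inner_sum, inner_smul_left, inner_smul_right, mul_sub, sub_mul,
        Finset.sum_sub_distrib, Finset.mul_sum]
      congr 1
      · refine Finset.sum_congr rfl fun x hx => ?_
        rw [Finset.sum_eq_single x]
        · simp only [if_true]
          rw [← Complex.conj_mul']; ring
        · intro y _ hy; simp [hy.symm]
        · intro h; exact absurd hx h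
      · rw [Finset.sum_comm]
        refine Finset.sum_congr rfl fun x _ => Finset.sum_congr rfl fun y _ => by ring
    rw [h2] at h1
    have := Complex.zero_le_real.1 h1
    linarith
  -- split
  have hs : ∀ {M : Type} [AddCommMonoid M] (f : ι × X → M), ∑ p ∈ s, f p =
      ∑ i, ∑ x ∈ (s.filter (fun p => p.1 = i)).image Prod.snd, f (i,x) := by
    intro M _ f
    rw [← Finset.sum_fiberwise s Prod.fst]
    refine Finset.sum_congr rfl fun i _ => ?_
    rw [Finset.sum_image]
    · refine Finset.sum_congr rfl fun p hp => ?_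
      simp at hp
      rw [← hp.2]
    · intro p hp q hq h
      simp at hp hq
      exact Prod.ext (hp.2.trans hq.2.symm) h
  rw [hs (fun p => c p • e p), hs (fun p => ‖c p‖ ^ 2)]
  calc _ ≤ (∑ i, ‖∑ x ∈ (s.filter (fun p => p.1 = i)).image Prod.snd, c (i,x) • e (i,x)‖) ^ 2 := by
        gcongr; exact norm_sum_le _ _
    _ ≤ (Finset.univ : Finset ι).card * ∑ i, ‖∑ x ∈ (s.filter (fun p => p.1 = i)).image Prod.snd, c (i,x) • e (i,x)‖ ^ 2 :=
        sq_sum_le_card_mul_sum_sq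
    _ ≤ Fintype.card ι * ∑ i, C * ∑ x ∈ (s.filter (fun p => p.1 = i)).image Prod.snd, ‖c (i,x)‖ ^ 2 := by
        rw [Finset.card_univ]
        gcongr with i _
        exact hblock _ _
    _ = _ := by rw [← Finset.mul_sum, mul_assoc]

/-- dual bound -/
lemma bessel {P H : Type} [NormedAddCommGroup H] [InnerProductSpace ℂ H] (e : P → H) (C : ℝ) (hC : 0 ≤ C)
    (h : ∀ (s : Finset P) (c : P → ℂ), ‖∑ p ∈ s, c p • e p‖ ^ 2 ≤ C * ∑ p ∈ s, ‖c p‖ ^ 2)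
    (v : H) (s : Finset P) : ∑ p ∈ s, ‖inner ℂ (e p) v‖ ^ 2 ≤ C * ‖v‖ ^ 2 := by
  set S := ∑ p ∈ s, ‖inner ℂ (e p) v‖ ^ 2 with hS
  have hS0 : 0 ≤ S := by positivity
  have h1 := h s (fun p => inner ℂ (e p) v)
  rw [← hS] at h1
  have h2 : (S : ℂ) = inner ℂ (∑ p ∈ s, (inner ℂ (e p) v : ℂ) • e p) v := by
    simp only [sum_inner, inner_smul_left, hS]
    push_cast
    exact Finset.sum_congr rfl fun p _ => by rw [← Complex.conj_mul']
  have h3 : S ≤ ‖∑ p ∈ s, (inner ℂ (e p) v : ℂ) • e p‖ * ‖v‖ := by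
    have := norm_inner_le_norm (𝕜 := ℂ) (∑ p ∈ s, (inner ℂ (e p) v : ℂ) • e p) v
    rw [← h2] at this
    simpa [abs_of_nonneg hS0] using this
  have h4 : S ^ 2 ≤ C * S * ‖v‖ ^ 2 := by
    calc S ^ 2 ≤ (‖∑ p ∈ s, (inner ℂ (e p) v : ℂ) • e p‖ * ‖v‖) ^ 2 := by gcongr
      _ ≤ _ := by rw [mul_pow]; gcongr
  rcases hS0.eq_or_lt with h5 | h5
  · rw [← h5]; positivity
  · nlinarith


noncomputable abbrev ell (P : Type) := lp (fun _ : P => ℂ) 2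

lemma exists_op {ι X : Type} [Fintype ι] [DecidableEq X] [DecidableEq ι]
    (k : ι × X → ι × X → ℂ) (hk : KP k) (C : ℝ) (hC : 0 ≤ C)
    (hb : ∀ i, KP fun x y : X => (C : ℂ) * (if x = y then 1 else 0) - k (i,x) (i,y)) :
    ∃ T : ell (ι × X) →L[ℂ] ell (ι × X), 0 ≤ T ∧
      (∀ p q, T (lp.single 2 q (1 : ℂ)) p = k p q) ∧ ‖T‖ ≤ Fintype.card ι * C := by
  obtain ⟨H, _, _, _, e, he⟩ := hk.exists_gram
  set D : ℝ := Fintype.card ι * C with hD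
  have hD0 : 0 ≤ D := by positivity
  have hbes := bessel e D hD0 (block_bound e C (by simpa only [he] using hb))
  have hmem : ∀ v : H, Memℓp (fun p => (inner ℂ (e p) v : ℂ)) 2 := fun v =>
    memℓp_gen' (C := D * ‖v‖ ^ 2) (by simpa using hbes v)
  let S0 : H →ₗ[ℂ] ell (ι × X) :=
    { toFun := fun v => ⟨fun p => inner ℂ (e p) v, hmem v⟩
      map_add' := fun v w => by
        apply lp.ext; funext p
        change (inner ℂ (e p) (v + w) : ℂ) = inner ℂ (e p) v + inner ℂ (e p) w
        exact inner_add_right _ _ _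
      map_smul' := fun c v => by
        apply lp.ext; funext p
        change (inner ℂ (e p) (c • v) : ℂ) = c * inner ℂ (e p) v
        exact inner_smul_right _ _ _ }
  have hS0 : ∀ v p, S0 v p = inner ℂ (e p) v := fun v p => rfl
  have hSn : ∀ v, ‖S0 v‖ ≤ √D * ‖v‖ := fun v => by
    refine lp.norm_le_of_forall_sum_le (by simp) (by positivity) fun s => ?_
    simp only [hS0]
    have := hbes v s
    simpa [mul_pow, Real.sq_sqrt hD0] using this
  let S : H →L[ℂ] ell (ι × X) := S0.mkContinuous _ hSn
  have hS : ∀ v p, S v p = inner ℂ (e p) v := fun v p => rfl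
  have hSn' : ‖S‖ ≤ √D := LinearMap.mkContinuous_norm_le _ (by positivity) _
  have hadj : ∀ q, S.adjoint (lp.single 2 q (1 : ℂ)) = e q := fun q => by
    refine ext_inner_right ℂ fun v => ?_
    rw [ContinuousLinearMap.adjoint_inner_left, lp.inner_single_left]
    simp [hS]
  refine ⟨S ∘L S.adjoint, ?_, fun p q => ?_, ?_⟩
  · rw [ContinuousLinearMap.nonneg_iff_isPositive]
    exact ContinuousLinearMap.isPositive_self_comp_adjoint S
  · simp [hadj, hS, he]
  · calc _ ≤ ‖S‖ * ‖S.adjoint‖ := ContinuousLinearMap.opNorm_comp_le _ _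
      _ = ‖S‖ * ‖S‖ := by simp
      _ ≤ √D * √D := by gcongr
      _ = D := Real.mul_self_sqrt hD0

section
variable {G F : Type} [Group G] [Group F] [DecidableEq F]

/-- the condition `C δ₁ - A(1,·)` positive definite -/
def Bdd (C : ℝ) (A : G × F → ℂ) : Prop :=
  PD fun w : F => (C : ℂ) * (if w = 1 then 1 else 0) - A (1, w)

lemma left_block {A : G × F → ℂ} {C : ℝ} (h : Bdd C A) :
    KP fun x y : F => (C : ℂ) * (if x = y then 1 else 0) - A (1, x⁻¹ * y) := by
  have : KP _ := h
  simpa [inv_mul_eq_one] using this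

lemma right_block {A : G × F → ℂ} {C : ℝ} (h : Bdd C A) :
    KP fun x y : F => (C : ℂ) * (if x = y then 1 else 0) - conj (A (1, x * y⁻¹)) := by
  have := (KP.comp h (fun x : F => x⁻¹)).conj
  simpa [mul_inv_eq_one, apply_ite] using this

lemma sq_summable {A : G × F → ℂ} (hA : PD A) {C : ℝ} (hC : 0 ≤ C) (h : Bdd C A) (g : G) :
    Summable (fun w => ‖A (g, w)‖ ^ 2) ∧ ∑' w, ‖A (g, w)‖ ^ 2 ≤ (2 * C) ^ 2 := by
  let gg : Bool → G := fun b => if b then g else 1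
  obtain ⟨T, hT0, hT, hTn⟩ := exists_op (ι := Bool) (X := F)
    (fun p q => A ((gg p.1)⁻¹ * gg q.1, p.2⁻¹ * q.2))
    (hA.kp fun p : Bool × F => (gg p.1, p.2)) C hC (fun i => by simpa using left_block h)
  set f := T (lp.single 2 (true, (1:F)) (1 : ℂ)) with hf
  have hf1 : ∀ w : F, f (false, w⁻¹) = A (g, w) := fun w => by rw [hf, hT]; simp [gg]
  have hfn : ‖f‖ ≤ 2 * C := by
    refine (T.le_opNorm _).trans ?_
    rw [lp.norm_single (by simp)]
    simpa using hTn
  have hsum : Summable fun p => ‖f p‖ ^ 2 := by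
    have := (lp.memℓp f).summable (by simp)
    simpa using this
  have hinj : Function.Injective (fun w : F => ((false, w⁻¹) : Bool × F)) := fun a b h => by
    simpa using h
  have hs2 := hsum.comp_injective hinj
  have e1 : ((fun p => ‖f p‖ ^ 2) ∘ (fun w : F => ((false, w⁻¹) : Bool × F))) =
    fun w => ‖A (g, w)‖ ^ 2 := by funext w; simp [hf1]
  rw [e1] at hs2
  refine ⟨hs2, ?_⟩
  have h3 := lp.norm_rpow_eq_tsum (p := 2) (by simp) f
  calc ∑' w, ‖A (g, w)‖ ^ 2 ≤ ∑' p, ‖f p‖ ^ 2 := by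
        rw [← e1]
        exact tsum_comp_le_tsum_of_inj hsum (fun _ => by positivity) hinj
    _ = ‖f‖ ^ 2 := by simpa using h3.symm
    _ ≤ _ := by gcongr

lemma pair_summable {A B : G × F → ℂ} (hA : PD A) (hB : PD B) {C : ℝ} (hC : 0 ≤ C) (hA' : Bdd C A)
    (hB' : Bdd C B) (g : G) : Summable (fun w => ‖A (g, w)‖ * ‖B (g, w)‖) ∧
      ∑' w, ‖A (g, w)‖ * ‖B (g, w)‖ ≤ (2 * C) ^ 2 := by
  obtain ⟨h1, h2⟩ := sq_summable hA hC hA' g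
  obtain ⟨h3, h4⟩ := sq_summable hB hC hB' g
  have h5 : ∀ w, ‖A (g, w)‖ * ‖B (g, w)‖ ≤ (‖A (g, w)‖ ^ 2 + ‖B (g, w)‖ ^ 2) * (1/2) := fun w => by
    nlinarith [sq_nonneg (‖A (g, w)‖ - ‖B (g, w)‖)]
  have h6 := (h1.add h3).mul_right (1/2)
  have h7 : Summable (fun w => ‖A (g, w)‖ * ‖B (g, w)‖) :=
    Summable.of_nonneg_of_le (fun w => by positivity) h5 h6
  refine ⟨h7, (h7.tsum_le_tsum h5 h6).trans ?_⟩
  rw [tsum_mul_right, h1.tsum_add h3]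
  linarith

lemma op_nonneg {H : Type} [NormedAddCommGroup H] [InnerProductSpace ℂ H] [CompleteSpace H]
    (a b : (H →L[ℂ] H)) (ha : 0 ≤ a) (hb : 0 ≤ b) (h : Commute a b) : 0 ≤ a * b :=
  h.mul_nonneg ha hb

lemma op_mul_apply {P : Type} [DecidableEq P] (L R : ell P →L[ℂ] ell P) (hL : IsSelfAdjoint L)
    (p q : P) : (L * R) (lp.single 2 q (1:ℂ)) p =
      ∑' r, conj (L (lp.single 2 p (1:ℂ)) r) * R (lp.single 2 q (1:ℂ)) r := by
  have h1 : (L * R) (lp.single 2 q (1:ℂ)) p =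
      inner ℂ (lp.single 2 p (1:ℂ)) ((L * R) (lp.single 2 q (1:ℂ))) := by
    rw [lp.inner_single_left]; simp
  rw [h1, mul_apply_eq_comp, ← ContinuousLinearMap.adjoint_inner_left,
    ← ContinuousLinearMap.star_eq_adjoint, hL.star_eq, lp.inner_eq_tsum]
  exact tsum_congr fun r => by simp [mul_comm]

lemma pairing {A B : G × F → ℂ} (hA : PD A) (hB : PD B) {C : ℝ} (hC : 0 ≤ C) (hA' : Bdd C A)
    (hB' : Bdd C B) : PD fun g => ∑' w, A (g, w) * conj (B (g, w)) := by
  classical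
  have key : ∀ (n : ℕ) (g : Fin n → G) (c : Fin n → ℂ),
      0 ≤ ∑ i, ∑ j, conj (c i) * (∑' w, A ((g i)⁻¹ * g j, w) * conj (B ((g i)⁻¹ * g j, w))) * c j := by
    intro n g c
    let P := (Fin n × Fin n) × F
    obtain ⟨L, hL0, hL, -⟩ := exists_op (ι := Fin n × Fin n) (X := F)
      (fun p q => (if p.1.2 = q.1.2 then 1 else 0) * A ((g p.1.1)⁻¹ * g q.1.1, p.2⁻¹ * q.2))
      ((KP.delta (fun p : P => p.1.2)).mul (hA.kp fun p : P => (g p.1.1, p.2))) C hC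
      (fun i => by simpa using left_block hA')
    obtain ⟨R, hR0, hR, -⟩ := exists_op (ι := Fin n × Fin n) (X := F)
      (fun p q => (if p.1.1 = q.1.1 then 1 else 0) * conj (B ((g p.1.2)⁻¹ * g q.1.2, p.2 * q.2⁻¹)))
      ((KP.delta (fun p : P => p.1.1)).mul (by
        simpa using (hB.kp fun p : P => (g p.1.2, p.2⁻¹)).conj)) C hC
      (fun i => by simpa using right_block hB')
    have hLs : IsSelfAdjoint L := hL0.isSelfAdjoint
    have hRs : IsSelfAdjoint R := hR0.isSelfAdjoint
    have hLR : ∀ p q : P, (L * R) (lp.single 2 q (1:ℂ)) p =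
        ∑' z : F, A ((g p.1.1)⁻¹ * g q.1.1, p.2⁻¹ * z) * conj (B ((g p.1.2)⁻¹ * g q.1.2, z * q.2⁻¹)) := by
      intro p q
      rw [op_mul_apply L R hLs]
      simp only [hL, hR]
      have hinj : Function.Injective (fun z : F => (((q.1.1, p.1.2), z) : P)) := fun a b h => by
        simpa using h
      rw [← hinj.tsum_eq]
      · refine tsum_congr fun z => ?_
        have := hA.herm ((g p.1.1)⁻¹ * g q.1.1, p.2⁻¹ * z)
        simp only [if_true, one_mul]
        rw [← this]
        simp
      · rintro ⟨⟨a, b⟩, z⟩ hr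
        simp at hr
        exact ⟨z, by simp [hr.1, hr.2.1.1]⟩
    have hRL : ∀ p q : P, (R * L) (lp.single 2 q (1:ℂ)) p =
        ∑' z : F, A ((g p.1.1)⁻¹ * g q.1.1, z⁻¹ * q.2) * conj (B ((g p.1.2)⁻¹ * g q.1.2, p.2 * z⁻¹)) := by
      intro p q
      rw [op_mul_apply R L hRs]
      simp only [hL, hR]
      have hinj : Function.Injective (fun z : F => (((p.1.1, q.1.2), z) : P)) := fun a b h => by
        simpa using h
      rw [← hinj.tsum_eq]
      · refine tsum_congr fun z => ?_
        have := hB.herm ((g p.1.2)⁻¹ * g q.1.2, p.2 * z⁻¹)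
        simp only [if_true, one_mul]
        rw [← this]
        simp [mul_comm]
      · rintro ⟨⟨a, b⟩, z⟩ hr
        simp at hr
        exact ⟨z, by simp [hr.1, hr.2.1.1]⟩
    have hcomm : Commute L R := by
      have h0 : ∀ q : P, (L * R) (lp.single 2 q (1:ℂ)) = (R * L) (lp.single 2 q (1:ℂ)) := fun q => by
        apply lp.ext; funext p
        rw [hLR, hRL]
        let e : F ≃ F := (Equiv.inv F).trans ((Equiv.mulLeft p.2).trans (Equiv.mulRight q.2))
        rw [← e.tsum_eq]
        refine tsum_congr fun z => ?_
        simp [e, mul_assoc]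
      have hs1 : ∀ (q : P) (a : ℂ), (lp.single 2 q a : ell P) = a • lp.single 2 q (1:ℂ) :=
        fun q a => by
          rw [← lp.single_smul]; simp
      refine ContinuousLinearMap.ext fun f => ?_
      have h2 := lp.hasSum_single (p := 2) (by simp) f
      have h3 := h2.mapL (L * R)
      have h4 := h2.mapL (R * L)
      have h5 : (fun b => (L * R) (lp.single 2 b (f b))) =
          fun b => (R * L) (lp.single 2 b (f b)) := by
        funext b
        rw [hs1, map_smul, map_smul, h0]
      rw [h5] at h3
      exact h3.unique h4
    have hpos : 0 ≤ L * R := op_nonneg _ _ hL0 hR0 hcomm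
    rw [ContinuousLinearMap.nonneg_iff_isPositive] at hpos
    have h1 := hpos.inner_nonneg_right (∑ i, c i • lp.single 2 (((i,i),1) : P) (1:ℂ))
    refine h1.trans_eq ?_
    simp only [sum_inner, map_sum, inner_sum, map_smul, inner_smul_left, inner_smul_right,
      lp.inner_single_left]
    rw [Finset.sum_comm]
    refine Finset.sum_congr rfl fun i _ => ?_
    rw [Finset.mul_sum]
    refine Finset.sum_congr rfl fun j _ => ?_
    have h7 := hLR ((j, j), 1) ((i, i), 1)
    simp at h7
    simp [h7]
    ring
  refine KP.mk (fun x y => ?_) fun s c => ?_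
  · have h1 := hA.herm (y⁻¹ * x, (1:F))
    rw [Complex.conj_tsum, ← (Equiv.inv F).tsum_eq]
    refine tsum_congr fun w => ?_
    have h1 := hA.herm (x⁻¹ * y, w)
    have h2 := hB.herm (x⁻¹ * y, w)
    rw [← h1, ← h2]
    simp
  · have := key s.card (fun i => (s.equivFin.symm i : G)) (fun i => c (s.equivFin.symm i))
    refine this.trans_eq ?_
    have e1 : ∀ f : G → ℂ, ∑ x ∈ s, f x = ∑ i : Fin s.card, f (s.equivFin.symm i) := fun f => by
      rw [← Finset.sum_coe_sort, ← s.equivFin.symm.sum_comp]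
    simp only [e1]
end
end CSid

namespace CSid
open scoped ComplexOrder ComplexConjugate
open Filter Topology

section
variable {β : Type} [DecidableEq β]

/-- length of the longest common initial segment -/
def lcp : List β → List β → ℕ
  | a :: X, b :: Y => if a = b then lcp X Y + 1 else 0
  | [], _ => 0
  | _ :: _, [] => 0

lemma le_lcp (X : List β) : ∀ (Y : List β) (k : ℕ),
    k ≤ lcp X Y ↔ k ≤ X.length ∧ k ≤ Y.length ∧ X.take k = Y.take k := by
  induction X with
  | nil => intro Y k; cases k <;> simp [lcp]
  | cons a X ih =>
    intro Y k
    cases Y with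
    | nil => cases k <;> simp [lcp]
    | cons b Y =>
      cases k with
      | zero => simp
      | succ k =>
        by_cases h : a = b
        · simp [lcp, h, ih]
        · simp [lcp, h]

lemma geom_aux (r : ℝ) (l : ℕ) : ∀ n m : ℕ, l ≤ n → l ≤ m →
    ∑ k ∈ Finset.range (l + 1), (if k = 0 then 1 else 1 - r ^ 2) * (r ^ (n - k) * r ^ (m - k))
      = r ^ (n + m - 2 * l) := by
  induction l with
  | zero => intro n m _ _; simp [pow_add]
  | succ l ih =>
    intro n m hn hm
    rw [Finset.sum_range_succ, ih n m (by omega) (by omega)]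
    obtain ⟨n', rfl⟩ := Nat.exists_eq_add_of_le hn
    obtain ⟨m', rfl⟩ := Nat.exists_eq_add_of_le hm
    have e1 : l + 1 + n' + (l + 1 + m') - 2 * l = n' + m' + 2 := by omega
    have e2 : l + 1 + n' + (l + 1 + m') - 2 * (l + 1) = n' + m' := by omega
    have e3 : l + 1 + n' - (l + 1) = n' := by omega
    have e4 : l + 1 + m' - (l + 1) = m' := by omega
    rw [e1, e2, e3, e4]
    simp; ring

lemma KP.lcp (r : ℝ) (h0 : 0 ≤ r) (h1 : r ≤ 1) :
    KP fun X Y : List β => ((r ^ (X.length + Y.length - 2 * lcp X Y) : ℝ) : ℂ) := by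
  let f : ℕ → List β → ℂ := fun k X => if k ≤ X.length then (r : ℂ) ^ (X.length - k) else 0
  let kk : ℕ → List β → List β → ℂ := fun k X Y =>
    ((if k = 0 then 1 else 1 - r ^ 2 : ℝ) : ℂ) *
      ((if X.take k = Y.take k then 1 else 0) * (conj (f k X) * f k Y))
  have hkk : ∀ k, KP (kk k) := fun k => by
    refine KP.smul ((KP.delta (fun X : List β => X.take k)).mul (KP.rank1 (f k))) ?_
    split_ifs
    · norm_num
    · nlinarith
  have hval : ∀ k X Y, kk k X Y = if k ≤ CSid.lcp X Y then
      (((if k = 0 then 1 else 1 - r ^ 2) * (r ^ (X.length - k) * r ^ (Y.length - k)) : ℝ) : ℂ)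
      else 0 := by
    intro k X Y
    by_cases h : k ≤ CSid.lcp X Y
    · have := (le_lcp X Y k).1 h
      simp only [kk, f, h, this, if_true]
      push_cast
      simp
    · rw [if_neg h]
      rw [le_lcp] at h
      simp only [kk, f]
      by_cases a : k ≤ X.length
      · by_cases b : k ≤ Y.length
        · have c : ¬ X.take k = Y.take k := fun c => h ⟨a, b, c⟩
          rw [if_neg c]; ring
        · rw [if_neg b]; ring
      · rw [if_neg a]; simp
  refine KP.lim (F := atTop) (k := fun N X Y => ∑ k ∈ Finset.range N, kk k X Y) (fun X Y => ?_)
    (Eventually.of_forall fun N => KP.sum _ fun k _ => hkk k)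
  refine tendsto_const_nhds.congr' ?_
  filter_upwards [eventually_ge_atTop (CSid.lcp X Y + 1)] with N hN
  have hl := (le_lcp X Y _).1 le_rfl
  rw [← geom_aux r _ _ _ hl.1 hl.2.1]
  push_cast
  simp only [hval]
  rw [← Finset.sum_subset (Finset.range_mono hN)]
  · refine Finset.sum_congr rfl fun k hk => ?_
    have hk' : k ≤ CSid.lcp X Y := by simpa [Nat.lt_succ_iff] using hk
    rw [if_pos hk']
    push_cast; rfl
  · intro k _ hk
    have hk' : ¬ k ≤ CSid.lcp X Y := by simpa [Nat.lt_succ_iff] using hk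
    rw [if_neg hk']
end

section
variable {α : Type} [DecidableEq α]
open FreeGroup

lemma norm_mk_red {L : List (α × Bool)} (h : FreeGroup.IsReduced L) :
    (FreeGroup.mk L).norm = L.length := by
  rw [FreeGroup.norm, FreeGroup.toWord_mk, h.reduce_eq]

lemma norm_lcp (X : List (α × Bool)) : ∀ Y : List (α × Bool), FreeGroup.IsReduced X →
    FreeGroup.IsReduced Y →
    ((FreeGroup.mk X)⁻¹ * FreeGroup.mk Y).norm + 2 * lcp X Y = X.length + Y.length := by
  induction X with
  | nil =>
    intro Y _ hY
    have : (FreeGroup.mk ([] : List (α × Bool)))⁻¹ = 1 := by simp [← FreeGroup.one_eq_mk]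
    rw [this, one_mul, norm_mk_red hY]
    simp [lcp]
  | cons a X ih =>
    intro Y hX hY
    cases Y with
    | nil =>
      rw [← FreeGroup.one_eq_mk, mul_one, FreeGroup.norm_inv_eq, norm_mk_red hX]
      simp [lcp]
    | cons b Y =>
      by_cases h : a = b
      · subst h
        have e : (FreeGroup.mk (a :: X))⁻¹ * FreeGroup.mk (a :: Y) =
            (FreeGroup.mk X)⁻¹ * FreeGroup.mk Y := by
          have : ∀ Z : List (α × Bool), FreeGroup.mk (a :: Z) = FreeGroup.mk [a] * FreeGroup.mk Z :=
            fun Z => by rw [FreeGroup.mul_mk]; rfl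
          rw [this X, this Y]; group
        have := ih Y (List.IsChain.tail hX) (List.IsChain.tail hY)
        rw [e]
        simp only [lcp, if_true, List.length_cons]
        omega
      · rw [FreeGroup.inv_mk, FreeGroup.mul_mk, norm_mk_red]
        · simp [lcp, h]
        · have h1 : FreeGroup.IsReduced (FreeGroup.invRev (a :: X)) := by
            rw [FreeGroup.isReduced_iff_reduce_eq, FreeGroup.reduce_invRev, hX.reduce_eq]
          unfold FreeGroup.IsReduced at *
          rw [List.isChain_append]
          refine ⟨h1, hY, ?_⟩
          intro x hx y hy
          simp [FreeGroup.invRev] at hx hy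
          subst hx hy
          intro h2
          simp at h2 ⊢
          by_contra h3
          apply h
          refine Prod.ext h2 ?_
          revert h3
          cases a.2 <;> cases b.2 <;> simp

lemma PD.pow_norm (r : ℝ) (h0 : 0 ≤ r) (h1 : r ≤ 1) :
    PD fun w : FreeGroup α => ((r ^ w.norm : ℝ) : ℂ) := by
  have := (KP.lcp (β := α × Bool) r h0 h1).comp (fun w : FreeGroup α => w.toWord)
  unfold PD
  convert this using 5 with x y
  have := norm_lcp x.toWord y.toWord FreeGroup.isReduced_toWord FreeGroup.isReduced_toWord
  simp only [FreeGroup.mk_toWord] at this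
  omega
end
end CSid

namespace CSid

lemma resfin {α : Type} [DecidableEq α] (S : Finset (FreeGroup α)) (hS : (1 : FreeGroup α) ∉ S) :
    ∃ (Q : Type) (_ : Group Q) (_ : Fintype Q) (q : FreeGroup α →* Q), ∀ w ∈ S, q w ≠ 1 := by
  classical
  let B : Finset (FreeGroup α) := insert 1
    (S.biUnion fun w => (w.toWord.tails.map FreeGroup.mk).toFinset)
  have h1B : (1 : FreeGroup α) ∈ B := by simp [B]
  have hB : ∀ w ∈ S, ∀ M, M <:+ w.toWord → FreeGroup.mk M ∈ B := fun w hw M hM => by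
    simp only [B, Finset.mem_insert, Finset.mem_biUnion]
    right
    refine ⟨w, hw, ?_⟩
    simp only [List.mem_toFinset, List.mem_map, List.mem_tails]
    exact ⟨M, hM, rfl⟩
  have hex : ∀ a : α, ∃ g : B ≃ B, ∀ b : B, FreeGroup.of a * (b : FreeGroup α) ∈ B →
      (g b : FreeGroup α) = FreeGroup.of a * b := by
    intro a
    obtain ⟨g, hg⟩ := Finset.exists_equiv_extend_of_card_eq (α := B) (t := B) (by simp)
      (s := Finset.univ.filter fun b : B => FreeGroup.of a * (b : FreeGroup α) ∈ B)
      (f := fun b => FreeGroup.of a * (b : FreeGroup α))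
      (by intro x hx
          simp only [Finset.mem_image, Finset.mem_filter] at hx
          obtain ⟨b, hb, rfl⟩ := hx
          exact hb.2)
      (by intro x _ y _ h; simpa using h)
    exact ⟨g, fun b hb => hg b (by simpa using hb)⟩
  choose g hg using hex
  let q : FreeGroup α →* Equiv.Perm B := FreeGroup.lift g
  refine ⟨Equiv.Perm B, inferInstance, inferInstance, q, fun w hw hq => ?_⟩
  have key : ∀ M : List (α × Bool), M <:+ w.toWord →
      ((q (FreeGroup.mk M) ⟨1, h1B⟩ : B) : FreeGroup α) = FreeGroup.mk M := by
    intro M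
    induction M with
    | nil => intro _; rw [← FreeGroup.one_eq_mk]; simp
    | cons a M ih =>
      intro hM
      have hM' : M <:+ w.toWord := (List.suffix_cons a M).trans hM
      have h1 := ih hM'
      have h2 := hB w hw _ hM
      have e : FreeGroup.mk (a :: M) = FreeGroup.mk [a] * FreeGroup.mk M := by
        rw [FreeGroup.mul_mk]; rfl
      rw [e] at h2 ⊢
      rw [map_mul, Equiv.Perm.mul_apply]
      set b := q (FreeGroup.mk M) ⟨1, h1B⟩ with hb
      rw [← h1] at h2 ⊢
      obtain ⟨a, s⟩ := a
      cases s
      · have e2 : FreeGroup.mk [(a, false)] = (FreeGroup.of a)⁻¹ := rfl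
        rw [e2] at h2 ⊢
        have h3 := hg a ⟨_, h2⟩ (by simp)
        have h4 : g a ⟨_, h2⟩ = b := Subtype.ext (by rw [h3]; simp)
        have h5 : q (FreeGroup.of a)⁻¹ b = ⟨_, h2⟩ := by
          rw [map_inv, Equiv.Perm.inv_eq_iff_eq]
          simp [q, h4]
        rw [h5]
      · have e2 : FreeGroup.mk [(a, true)] = FreeGroup.of a := rfl
        rw [e2] at h2 ⊢
        simpa [q] using hg a b h2
  have := key w.toWord List.suffix_rfl
  rw [FreeGroup.mk_toWord, hq] at this
  exact hS (by simpa [← this] using hw)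
end CSid

namespace CSid
open scoped ComplexOrder ComplexConjugate
open Filter Topology

lemma numrad {H : Type} [NormedAddCommGroup H] [InnerProductSpace ℂ H] (T : H →L[ℂ] H) (r : ℝ)
    (hr : 0 ≤ r) (h : ∀ v, ‖(inner ℂ v (T v) : ℂ)‖ ≤ r * ‖v‖ ^ 2) : ‖T‖ ≤ 2 * r := by
  have h' : ∀ v, ‖(inner ℂ (T v) v : ℂ)‖ ≤ r * ‖v‖ ^ 2 := fun v => by
    rw [norm_inner_symm]; exact h v
  have pol : ∀ x y, ‖(inner ℂ (T y) x : ℂ)‖ ≤ r * (‖x‖ ^ 2 + ‖y‖ ^ 2) := by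
    intro x y
    have h1 := inner_map_polarization (T : H →ₗ[ℂ] H) x y
    simp only [ContinuousLinearMap.coe_coe] at h1
    rw [h1]
    have par := fun y : H => parallelogram_law_with_norm ℂ x y
    have p1 := par y
    have p2 := par (Complex.I • y)
    rw [norm_smul, Complex.norm_I, one_mul] at p2
    rw [norm_div]
    have h4 : ‖(4 : ℂ)‖ = 4 := by norm_num
    rw [h4, div_le_iff₀ (by norm_num)]
    set a := (inner ℂ (T (x + y)) (x + y) : ℂ)
    set b := (inner ℂ (T (x - y)) (x - y) : ℂ)
    set c := (inner ℂ (T (x + Complex.I • y)) (x + Complex.I • y) : ℂ)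
    set d := (inner ℂ (T (x - Complex.I • y)) (x - Complex.I • y) : ℂ)
    have n1 : ‖a - b + Complex.I * c - Complex.I * d‖ ≤ ‖a‖ + ‖b‖ + ‖c‖ + ‖d‖ := by
      refine (norm_sub_le _ _).trans ?_
      refine add_le_add ((norm_add_le _ _).trans (add_le_add (norm_sub_le _ _) ?_)) ?_
      · simp
      · simp
    have ha := h' (x + y)
    have hb := h' (x - y)
    have hc := h' (x + Complex.I • y)
    have hd := h' (x - Complex.I • y)
    calc _ ≤ ‖a‖ + ‖b‖ + ‖c‖ + ‖d‖ := n1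
      _ ≤ r * ‖x + y‖ ^ 2 + r * ‖x - y‖ ^ 2 + r * ‖x + Complex.I • y‖ ^ 2
          + r * ‖x - Complex.I • y‖ ^ 2 := by gcongr
      _ = r * (‖x + y‖ ^ 2 + ‖x - y‖ ^ 2) + r * (‖x + Complex.I • y‖ ^ 2
          + ‖x - Complex.I • y‖ ^ 2) := by ring
      _ = _ := by rw [p1, p2]; ring
  refine T.opNorm_le_bound (by positivity) fun y => ?_
  rcases eq_or_ne (T y) 0 with h0 | h0
  · rw [h0]; simp; positivity
  have hy0 : y ≠ 0 := by rintro rfl; simp at h0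
  have n1 : 0 < ‖T y‖ := norm_pos_iff.2 h0
  have n2 : 0 < ‖y‖ := norm_pos_iff.2 hy0
  have := pol (((‖y‖ / ‖T y‖ : ℝ) : ℂ) • T y) y
  rw [inner_smul_right, norm_smul, norm_mul, inner_self_eq_norm_sq_to_K] at this
  simp at this
  have e1 : ‖y‖ / ‖T y‖ * ‖T y‖ ^ 2 = ‖y‖ * ‖T y‖ := by field_simp
  have e2 : ‖y‖ / ‖T y‖ * ‖T y‖ = ‖y‖ := by field_simp
  rw [e1, e2] at this
  nlinarith

section
variable {G : Type} {Λ : Set G} {N : ℕ} {H : Type} [NormedAddCommGroup H] [InnerProductSpace ℂ H]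

lemma sidonOp_apply (a : ↥Λ →₀ Matrix (Fin N) (Fin N) ℂ) (v : ↥Λ → H →L[ℂ] H)
    (x : PiLp 2 (fun _ : Fin N => H)) (i : Fin N) :
    sidonOp a v x i = ∑ t ∈ a.support, ∑ j, (a t i j) • v t (x j) := by
  simp [sidonOp]

lemma sidon_inner (a : ↥Λ →₀ Matrix (Fin N) (Fin N) ℂ) (v : ↥Λ → H →L[ℂ] H) (T : Finset ↥Λ)
    (hT : a.support ⊆ T) (x : PiLp 2 (fun _ : Fin N => H)) :
    (inner ℂ x (sidonOp a v x) : ℂ) = ∑ t ∈ T, ∑ l, ∑ m, a t l m * inner ℂ (x l) (v t (x m)) := by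
  rw [PiLp.inner_apply]
  simp only [sidonOp_apply, inner_sum, inner_smul_right]
  rw [Finset.sum_comm]
  refine Finset.sum_subset hT fun t _ ht => ?_
  simp only [Finsupp.mem_support_iff, not_not] at ht
  simp [ht]

lemma sandwich (M D : Matrix (Fin N) (Fin N) ℂ) (P : H →L[ℂ] H) (x : Fin N → H) :
    ∑ i, ∑ j, M i j * inner ℂ (∑ l, D i l • x l) (P (∑ m, D j m • x m)) =
      ∑ l, ∑ m, (D.conjTranspose * M * D) l m * (inner ℂ (x l) (P (x m)) : ℂ) := by
  simp only [map_sum, map_smul, sum_inner, inner_sum, inner_smul_left, inner_smul_right,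
    Matrix.mul_apply, Matrix.conjTranspose_apply, Finset.mul_sum, Finset.sum_mul]
  have sw : ∀ f : Fin N → Fin N → Fin N → Fin N → ℂ, ∑ l, ∑ m, ∑ j, ∑ i, f i j l m =
      ∑ i, ∑ j, ∑ l, ∑ m, f i j l m := fun f => by
    calc ∑ l, ∑ m, ∑ j, ∑ i, f i j l m = ∑ l, ∑ j, ∑ m, ∑ i, f i j l m :=
          Finset.sum_congr rfl fun l _ => Finset.sum_comm
      _ = ∑ j, ∑ l, ∑ m, ∑ i, f i j l m := Finset.sum_comm
      _ = ∑ j, ∑ l, ∑ i, ∑ m, f i j l m :=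
          Finset.sum_congr rfl fun j _ => Finset.sum_congr rfl fun l _ => Finset.sum_comm
      _ = ∑ j, ∑ i, ∑ l, ∑ m, f i j l m :=
          Finset.sum_congr rfl fun j _ => Finset.sum_comm
      _ = _ := Finset.sum_comm
  rw [sw]
  refine Finset.sum_congr rfl fun i _ => Finset.sum_congr rfl fun j _ => ?_
  rw [Finset.sum_comm]
  refine Finset.sum_congr rfl fun l _ => Finset.sum_congr rfl fun m _ => ?_
  simp
  ring

open scoped MatrixOrder in
lemma exists_factor {n : ℕ} (ρ : Matrix (Fin n) (Fin n) ℂ) (h : ρ.PosDef) :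
    ∃ B D : Matrix (Fin n) (Fin n) ℂ, D * B = 1 ∧ D.conjTranspose * ρ * D = 1 := by
  obtain ⟨B, rfl⟩ := CStarAlgebra.nonneg_iff_eq_star_mul_self.mp h.posSemidef.nonneg
  have hu : IsUnit B := by
    have h1 := h.isUnit
    rw [Matrix.isUnit_iff_isUnit_det, Matrix.det_mul] at h1
    rw [Matrix.isUnit_iff_isUnit_det]
    exact isUnit_of_mul_isUnit_right h1
  obtain ⟨u, rfl⟩ := hu
  refine ⟨↑u, ↑(u⁻¹), by simp, ?_⟩
  rw [Matrix.star_eq_conjTranspose]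
  have : (u : Matrix (Fin n) (Fin n) ℂ) * ((u⁻¹ : (Matrix (Fin n) (Fin n) ℂ)ˣ) : Matrix (Fin n) (Fin n) ℂ) = 1 := by simp
  rw [mul_assoc, mul_assoc, this, mul_one, ← Matrix.conjTranspose_mul, this]
  simp

lemma re_bound {z : ℂ} {r : ℝ} (h : ∀ k : Fin 4, (Complex.I ^ (k : ℕ) * z).re ≤ r) : ‖z‖ ≤ 2 * r := by
  have h0 := h 0
  have h1 := h 1
  have h2 := h 2
  have h3 := h 3
  simp [pow_succ] at h0 h1 h2 h3
  have := Complex.norm_le_abs_re_add_abs_im z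
  have a1 : |z.re| ≤ r := abs_le.2 ⟨by linarith, h0⟩
  have a2 : |z.im| ≤ r := abs_le.2 ⟨by linarith, by linarith⟩
  linarith

lemma step1core {G : Type} [Group G] {Λ : Set G} {C : ℝ} (hC : 0 ≤ C) (hΛ : IsCompletelySidon Λ C)
    {n : ℕ} (T : Finset ↥Λ) (U : ↥Λ → unitary (Matrix (Fin n) (Fin n) ℂ))
    (a : ↥Λ → Matrix (Fin n) (Fin n) ℂ) (σ : Matrix (Fin n) (Fin n) ℂ) (hσ : σ.PosSemidef)
    (h : ∀ (H : Type) [NormedAddCommGroup H] [InnerProductSpace ℂ H] [CompleteSpace H]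
      (π : G →* unitary (H →L[ℂ] H)) (ξ : Fin n → H) (k : Fin 4),
      (Complex.I ^ (k : ℕ) * ∑ t ∈ T, ∑ i, ∑ j, a t i j * inner ℂ (ξ i) ((π (t : G) : H →L[ℂ] H) (ξ j))).re
        ≤ (∑ i, ∑ j, σ i j * inner ℂ (ξ i) (ξ j)).re) :
    (∑ t ∈ T, ∑ i, ∑ j, a t i j * (U t : Matrix (Fin n) (Fin n) ℂ) i j).re ≤ 4 * C * σ.trace.re := by
  classical
  have main : ∀ s : ℝ, 0 < s →
      (∑ t ∈ T, ∑ i, ∑ j, a t i j * (U t : Matrix (Fin n) (Fin n) ℂ) i j).re ≤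
        4 * C * (σ.trace.re + n * s) := by
    intro s hs
    let ρ := σ + (s : ℂ) • (1 : Matrix (Fin n) (Fin n) ℂ)
    have hρ : ρ.PosDef := Matrix.PosDef.posSemidef_add hσ
      (Matrix.PosDef.smul Matrix.PosDef.one (by exact_mod_cast hs))
    obtain ⟨B, D, hDB, hD⟩ := exists_factor ρ hρ
    let a' : ↥Λ →₀ Matrix (Fin n) (Fin n) ℂ := Finsupp.indicator T
      (fun t _ => D.conjTranspose * a t * D)
    have ha'T : a'.support ⊆ T := Finsupp.support_indicator_subset _ _
    have ha' : ∀ t ∈ T, a' t = D.conjTranspose * a t * D := fun t ht => by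
      simp [a', Finsupp.indicator_apply, ht]
    -- the quadratic form
    have hq : ∀ {H : Type} [NormedAddCommGroup H] [InnerProductSpace ℂ H] (v : ↥Λ → H →L[ℂ] H)
        (x : PiLp 2 (fun _ : Fin n => H)), (inner ℂ x (sidonOp a' v x) : ℂ) =
        ∑ t ∈ T, ∑ i, ∑ j, a t i j * inner ℂ (∑ l, D i l • x l) (v t (∑ m, D j m • x m)) := by
      intro H _ _ v x
      rw [sidon_inner a' v T ha'T]
      refine Finset.sum_congr rfl fun t ht => ?_
      rw [sandwich, ha' t ht]
    have hn : ∀ {H : Type} [NormedAddCommGroup H] [InnerProductSpace ℂ H]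
        (x : PiLp 2 (fun _ : Fin n => H)), 
        ∑ i, ∑ j, ρ i j * inner ℂ (∑ l, D i l • x l) (∑ m, D j m • x m) = ((‖x‖ ^ 2 : ℝ) : ℂ) := by
      intro H _ _ x
      have := sandwich ρ D (ContinuousLinearMap.id ℂ H) x
      simp only [ContinuousLinearMap.id_apply] at this
      rw [this, hD]
      have h2 := inner_self_eq_norm_sq_to_K (𝕜 := ℂ) x
      push_cast
      refine Eq.trans ?_ h2
      rw [PiLp.inner_apply]
      simp [Matrix.one_apply]
    have hρσ : ∀ {H : Type} [NormedAddCommGroup H] [InnerProductSpace ℂ H] (ξ : Fin n → H),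
        (∑ i, ∑ j, σ i j * inner ℂ (ξ i) (ξ j)).re ≤ (∑ i, ∑ j, ρ i j * inner ℂ (ξ i) (ξ j)).re := by
      intro H _ _ ξ
      have : ∑ i, ∑ j, ρ i j * inner ℂ (ξ i) (ξ j) = ∑ i, ∑ j, σ i j * inner ℂ (ξ i) (ξ j) +
          ((s * ∑ i, ‖ξ i‖ ^ 2 : ℝ) : ℂ) := by
        simp only [ρ, Matrix.add_apply, add_mul, Finset.sum_add_distrib]
        congr 1
        simp [Matrix.one_apply, Finset.mul_sum]
      rw [this, Complex.add_re, Complex.ofReal_re]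
      have : 0 ≤ s * ∑ i, ‖ξ i‖ ^ 2 := by positivity
      linarith
    let V : ↥Λ → unitary (EuclideanSpace ℂ (Fin n) →L[ℂ] EuclideanSpace ℂ (Fin n)) := fun t =>
      ⟨Matrix.toEuclideanCLM (n := Fin n) (𝕜 := ℂ) (U t : Matrix (Fin n) (Fin n) ℂ), by
        have h1 := (Unitary.mem_iff.1 (U t).2)
        rw [Unitary.mem_iff, ← map_star, ← map_mul, ← map_mul, h1.1, h1.2, map_one]
        exact ⟨rfl, rfl⟩⟩
    have hS := hΛ n a' 4 (by norm_num) (fun H _ _ _ π => by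
      have := numrad (sidonOp a' (fun t => ((π (t : G) : unitary (H →L[ℂ] H)) : H →L[ℂ] H))) 2
        (by norm_num) (fun x => by
          refine re_bound fun k => ?_
          rw [hq]
          refine (h H π _ k).trans ((hρσ _).trans ?_)
          rw [hn, Complex.ofReal_re])
      linarith) (EuclideanSpace ℂ (Fin n))
      V
    set S := sidonOp a' (fun t => ((V t : unitary (EuclideanSpace ℂ (Fin n) →L[ℂ] EuclideanSpace ℂ (Fin n))) : EuclideanSpace ℂ (Fin n) →L[ℂ] EuclideanSpace ℂ (Fin n))) with hSdef
    let e : Fin n → EuclideanSpace ℂ (Fin n) := fun j => EuclideanSpace.single j (1 : ℂ)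
    let η : PiLp 2 (fun _ : Fin n => EuclideanSpace ℂ (Fin n)) :=
      WithLp.toLp 2 (fun l => ∑ j, B l j • e j)
    have hη : ∀ i, ∑ l, D i l • η l = e i := by
      intro i
      have : ∀ l, η l = ∑ j, B l j • e j := fun l => rfl
      simp only [this, Finset.smul_sum, smul_smul]
      rw [Finset.sum_comm]
      simp only [← Finset.sum_smul, ← Matrix.mul_apply, hDB]
      simp [Matrix.one_apply]
    have hin : ∀ i j, (inner ℂ (e i) (e j) : ℂ) = if i = j then 1 else 0 := by
      intro i j
      simp [e, EuclideanSpace.inner_single_left]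
    have hinU : ∀ (t : ↥Λ) i j, (inner ℂ (e i) ((V t : EuclideanSpace ℂ (Fin n) →L[ℂ] EuclideanSpace ℂ (Fin n)) (e j)) : ℂ)
        = (U t : Matrix (Fin n) (Fin n) ℂ) i j := by
      intro t i j
      simp [e, V, EuclideanSpace.inner_single_left, Matrix.ofLp_toEuclideanCLM]
    have q1 := hq (fun t => ((V t : unitary (EuclideanSpace ℂ (Fin n) →L[ℂ] EuclideanSpace ℂ (Fin n))) : EuclideanSpace ℂ (Fin n) →L[ℂ] EuclideanSpace ℂ (Fin n))) η
    simp only [hη, hinU] at q1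
    have n1 := hn η
    simp only [hη, hin] at n1
    have n2 : ‖η‖ ^ 2 = σ.trace.re + n * s := by
      have : ((‖η‖ ^ 2 : ℝ) : ℂ) = σ.trace + n * s := by
        rw [← n1]
        simp [ρ, Matrix.trace, Finset.sum_add_distrib]
      have := congrArg Complex.re this
      rw [Complex.ofReal_re] at this
      simpa using this
    rw [← q1, ← n2]
    calc _ ≤ ‖(inner ℂ η (S η) : ℂ)‖ := Complex.re_le_norm _
      _ ≤ ‖η‖ * ‖S η‖ := norm_inner_le_norm _ _
      _ ≤ ‖η‖ * ((C * 4) * ‖η‖) := by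
        gcongr
        exact S.le_of_opNorm_le hS η
      _ = _ := by ring
  refine le_of_forall_pos_le_add fun ε hε => ?_
  have := main (ε / (4 * C * n + 1)) (by positivity)
  refine this.trans ?_
  have : 4 * C * n * (ε / (4 * C * n + 1)) ≤ ε := by
    rw [mul_div_assoc', div_le_iff₀ (by positivity)]
    nlinarith
  linarith
end

end CSid

namespace CSid
open scoped ComplexOrder ComplexConjugate
open Filter Topology

section
variable {G : Type} [Group G] {Λ : Set G} {n : ℕ}

/-- the evaluation point in the finite-dimensional separation argument -/
noncomputable def evp (T : Finset ↥Λ) (u : Fin 4 → G → Fin n → Fin n → ℂ) (y : Fin n → Fin n → ℂ) :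
    Option ↥T × Fin n × Fin n → ℂ := fun p =>
  match p.1 with
  | none => ∑ k, u k 1 p.2.1 p.2.2 + y p.2.1 p.2.2
  | some t => ∑ k : Fin 4, Complex.I ^ (k : ℕ) * u k ((t : ↥Λ) : G) p.2.1 p.2.2

/-- the cone -/
def cone (T : Finset ↥Λ) (n : ℕ) : Set (Option ↥T × Fin n × Fin n → ℂ) :=
  {x | ∃ u y, (∀ k : Fin 4, KP fun p q : G × Fin n => u k (p.1⁻¹ * q.1) p.2 q.2) ∧ KP y ∧
    x = evp T u y}

lemma cone_add {T : Finset ↥Λ} {x x'} (h : x ∈ cone T n) (h' : x' ∈ cone T n) :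
    x + x' ∈ cone T n := by
  obtain ⟨u, y, hu, hy, rfl⟩ := h
  obtain ⟨u', y', hu', hy', rfl⟩ := h'
  refine ⟨fun k g i j => u k g i j + u' k g i j, fun i j => y i j + y' i j,
    fun k => (hu k).add (hu' k), hy.add hy', ?_⟩
  funext ⟨o, i, j⟩
  cases o
  · simp [evp, Finset.sum_add_distrib]; ring
  · simp [evp, Finset.sum_add_distrib, mul_add]

lemma cone_smul {T : Finset ↥Λ} {x} (h : x ∈ cone T n) {r : ℝ} (hr : 0 ≤ r) :
    r • x ∈ cone T n := by
  obtain ⟨u, y, hu, hy, rfl⟩ := h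
  refine ⟨fun k g i j => (r : ℂ) * u k g i j, fun i j => (r : ℂ) * y i j,
    fun k => (hu k).smul hr, hy.smul hr, ?_⟩
  funext ⟨o, i, j⟩
  cases o
  · simp [evp, Finset.mul_sum, mul_add]
  · simp only [Pi.smul_apply, evp, Complex.real_smul, Finset.mul_sum]
    refine Finset.sum_congr rfl fun k _ => by ring

lemma cone_zero {T : Finset ↥Λ} : (0 : Option ↥T × Fin n × Fin n → ℂ) ∈ cone T n := by
  refine ⟨fun _ _ _ _ => 0, fun _ _ => 0, fun _ => KP.zero, KP.zero, ?_⟩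
  funext ⟨o, i, j⟩
  cases o <;> simp [evp]

lemma cone_convex {T : Finset ↥Λ} : Convex ℝ (cone T n) := by
  intro x hx y hy a b ha hb _
  exact cone_add (cone_smul hx ha) (cone_smul hy hb)

lemma f_expand {T : Finset ↥Λ} (f : (Option ↥T × Fin n × Fin n → ℂ) →L[ℂ] ℂ) :
    ∃ (a : ↥Λ → Matrix (Fin n) (Fin n) ℂ) (b : Matrix (Fin n) (Fin n) ℂ),
      ∀ (v : ↥Λ → Fin n → Fin n → ℂ) (z : Fin n → Fin n → ℂ),
      f (fun p => match p.1 with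
        | none => z p.2.1 p.2.2
        | some t => v (t : ↥Λ) p.2.1 p.2.2) =
        (∑ t ∈ T, ∑ i, ∑ j, a t i j * v t i j) - ∑ i, ∑ j, b i j * z i j := by
  classical
  refine ⟨fun t i j => if h : t ∈ T then f (fun q => if (some ⟨t, h⟩, i, j) = q then 1 else 0) else 0,
    fun i j => - f (fun q => if (none, i, j) = q then 1 else 0), fun v z => ?_⟩
  have h := LinearMap.pi_apply_eq_sum_univ (f : (Option ↥T × Fin n × Fin n → ℂ) →ₗ[ℂ] ℂ)
    (fun p => match p.1 with
        | none => z p.2.1 p.2.2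
        | some t => v (t : ↥Λ) p.2.1 p.2.2)
  rw [ContinuousLinearMap.coe_coe] at h
  rw [h, Fintype.sum_prod_type, Fintype.sum_option, add_comm, sub_eq_add_neg]
  congr 1
  · rw [← Finset.sum_coe_sort T]
    refine Finset.sum_congr rfl fun t _ => ?_
    rw [Fintype.sum_prod_type]
    refine Finset.sum_congr rfl fun i _ => Finset.sum_congr rfl fun j _ => ?_
    simp [mul_comm]
  · rw [Fintype.sum_prod_type, ← Finset.sum_neg_distrib]
    refine Finset.sum_congr rfl fun i _ => ?_
    rw [← Finset.sum_neg_distrib]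
    refine Finset.sum_congr rfl fun j _ => ?_
    simp [mul_comm]

lemma herm_re (b : Matrix (Fin n) (Fin n) ℂ) (y : Fin n → Fin n → ℂ) (hy : ∀ i j, conj (y j i) = y i j) :
    (∑ i, ∑ j, ((1 / 2 : ℂ) * (b i j + conj (b j i))) * y i j).re = (∑ i, ∑ j, b i j * y i j).re := by
  have h1 : ∑ i, ∑ j, ((1 / 2 : ℂ) * (b i j + conj (b j i))) * y i j =
      (1 / 2 : ℂ) * (∑ i, ∑ j, b i j * y i j + conj (∑ i, ∑ j, b i j * y i j)) := by
    have h2 : conj (∑ i, ∑ j, b i j * y i j) = ∑ i, ∑ j, conj (b j i) * y i j := by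
      rw [Finset.sum_comm]
      simp only [map_sum, map_mul, hy]
    rw [h2]
    simp only [← Finset.sum_add_distrib, Finset.mul_sum]
    refine Finset.sum_congr rfl fun i _ => Finset.sum_congr rfl fun j _ => ?_
    ring
  rw [h1, Complex.add_conj]
  simp

lemma step1 {C : ℝ} (hC : 0 ≤ C) (hΛ : IsCompletelySidon Λ C)
    (T : Finset ↥Λ) (U : ↥Λ → unitary (Matrix (Fin n) (Fin n) ℂ)) {ε : ℝ} (hε : 0 < ε) :
    ∃ (u : Fin 4 → G → Fin n → Fin n → ℂ) (y : Fin n → Fin n → ℂ),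
      (∀ k : Fin 4, KP fun p q : G × Fin n => u k (p.1⁻¹ * q.1) p.2 q.2) ∧ KP y ∧
      (∀ t ∈ T, ∀ i j, ‖∑ k : Fin 4, Complex.I ^ (k : ℕ) * u k (t : G) i j
          - (U t : Matrix (Fin n) (Fin n) ℂ) i j‖ < ε) ∧
      ∀ i j, ‖∑ k, u k 1 i j + y i j - (4 * C : ℝ) * (1 : Matrix (Fin n) (Fin n) ℂ) i j‖ < ε := by
  classical
  let x0 : Option ↥T × Fin n × Fin n → ℂ := fun p => match p.1 with
        | none => ((4 * C : ℝ) * (1 : Matrix (Fin n) (Fin n) ℂ) p.2.1 p.2.2)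
        | some t => (U (t : ↥Λ) : Matrix (Fin n) (Fin n) ℂ) p.2.1 p.2.2
  have hx0 : x0 ∈ closure (cone T n) := by
    by_contra hx
    obtain ⟨f, c, hf, hc⟩ := RCLike.geometric_hahn_banach_closed_point (𝕜 := ℂ)
      (cone_convex (T := T) (n := n)).closure isClosed_closure hx
    simp only [RCLike.re_eq_complex_re] at hf hc
    have hf' : ∀ x ∈ cone T n, (f x).re < c := fun x hx => hf x (subset_closure hx)
    have hc0 : 0 < c := by simpa using hf' 0 cone_zero
    have hf0 : ∀ x ∈ cone T n, (f x).re ≤ 0 := by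
      intro x hx
      by_contra! h
      have h1 := hf' _ (cone_smul hx (r := c / (f x).re) (by positivity))
      have h2 : f ((c / (f x).re) • x) = ((c / (f x).re : ℝ) : ℂ) * f x := by
        rw [← smul_eq_mul, ← map_smul]; congr 1
      rw [h2, Complex.re_ofReal_mul, div_mul_cancel₀ _ h.ne'] at h1
      exact lt_irrefl _ h1
    obtain ⟨a, b, hab⟩ := f_expand f
    have hab' : ∀ (u : Fin 4 → G → Fin n → Fin n → ℂ) (y : Fin n → Fin n → ℂ), f (evp T u y) =
        (∑ t ∈ T, ∑ i, ∑ j, a t i j * ∑ k : Fin 4, Complex.I ^ (k : ℕ) * u k (t : G) i j) -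
          ∑ i, ∑ j, b i j * (∑ k, u k 1 i j + y i j) := fun u y => hab
      (fun t i j => ∑ k : Fin 4, Complex.I ^ (k : ℕ) * u k (t : G) i j)
      (fun i j => ∑ k, u k 1 i j + y i j)
    have hab0 := hab (fun t => (U t : Matrix (Fin n) (Fin n) ℂ))
      (fun i j => ((4 * C : ℝ) * (1 : Matrix (Fin n) (Fin n) ℂ) i j))
    let σ : Matrix (Fin n) (Fin n) ℂ := fun i j => (1 / 2 : ℂ) * (b i j + conj (b j i))
    have hσ : σ.PosSemidef := by
      have : KP σ := by
        have hH : ∀ i j, conj (σ j i) = σ i j := fun i j => by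
          have : conj (2 : ℂ) = 2 := Complex.conj_ofNat 2
          simp [σ, add_comm, this]
        have key : ∀ c : Fin n → ℂ, 0 ≤ ∑ i, ∑ j, conj (c i) * σ i j * c j := by
          intro c
          have e1 : ∑ i, ∑ j, conj (c i) * σ i j * c j = ∑ i, ∑ j, σ i j * (conj (c i) * c j) :=
            Finset.sum_congr rfl fun i _ => Finset.sum_congr rfl fun j _ => by ring
          have hr := KP.rank1 c
          have h1 := hf0 _ ⟨fun _ _ _ _ => 0, fun i j => conj (c i) * c j, fun _ => KP.zero, hr, rfl⟩
          rw [hab'] at h1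
          simp only [mul_zero, Finset.sum_const_zero, zero_sub, zero_add, Complex.neg_re] at h1
          rw [← herm_re b (fun i j => conj (c i) * c j) hr.herm] at h1
          rw [e1, Complex.le_def]
          refine ⟨by simp only [Complex.zero_re]; linarith, ?_⟩
          have : conj (∑ i, ∑ j, σ i j * (conj (c i) * c j)) = ∑ i, ∑ j, σ i j * (conj (c i) * c j) := by
            simp only [map_sum]
            rw [Finset.sum_comm]
            refine Finset.sum_congr rfl fun i _ => Finset.sum_congr rfl fun j _ => ?_
            rw [map_mul, hH, map_mul, Complex.conj_conj]
            ring
          exact (Complex.conj_eq_iff_im.1 this).symm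
        refine KP.mk hH fun s c => ?_
        have := key (fun i => if i ∈ s then c i else 0)
        refine this.trans_eq ?_
        rw [← Finset.sum_subset (Finset.subset_univ s) (fun i _ hi => by simp [hi])]
        refine Finset.sum_congr rfl fun i hi => ?_
        rw [← Finset.sum_subset (Finset.subset_univ s) (fun i _ hi => by simp [hi])]
        refine Finset.sum_congr rfl fun j hj => ?_
        simp [hi, hj]
      exact this
    have h1 := step1core hC hΛ T U a σ hσ (by
      intro H _ _ _ π ξ k
      have hk : ∀ k', KP fun p q : G × Fin n => if k' = k then
          (inner ℂ (ξ p.2) ((π (p.1⁻¹ * q.1) : H →L[ℂ] H) (ξ q.2)) : ℂ) else 0 := by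
        intro k'
        split_ifs
        · have := KP.gram (fun p : G × Fin n => (π p.1 : H →L[ℂ] H) (ξ p.2))
          convert this using 3 with p q
          rw [map_mul, map_inv]
          have : (((π p.1)⁻¹ * π q.1 : unitary (H →L[ℂ] H)) : H →L[ℂ] H) =
            ContinuousLinearMap.adjoint (π p.1 : H →L[ℂ] H) * (π q.1 : H →L[ℂ] H) := rfl
          rw [this, mul_apply_eq_comp, ContinuousLinearMap.adjoint_inner_right]
        · exact KP.zero
      have h1 := hf0 _ ⟨fun k' g i j => if k' = k then
          (inner ℂ (ξ i) ((π g : H →L[ℂ] H) (ξ j)) : ℂ) else 0, fun _ _ => 0, hk, KP.zero, rfl⟩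
      rw [hab'] at h1
      simp only [mul_ite, mul_zero, Finset.sum_ite_eq', Finset.mem_univ, if_true, map_one, add_zero,
        Complex.sub_re, OneMemClass.coe_one, one_apply_eq_self] at h1
      rw [← herm_re b (fun i j => inner ℂ (ξ i) (ξ j)) (fun i j => by simp)] at h1
      have e2 : Complex.I ^ (k : ℕ) * ∑ t ∈ T, ∑ i, ∑ j, a t i j * inner ℂ (ξ i) ((π (t : G) : H →L[ℂ] H) (ξ j))
        = ∑ t ∈ T, ∑ i, ∑ j, a t i j * (Complex.I ^ (k : ℕ) * inner ℂ (ξ i) ((π (t : G) : H →L[ℂ] H) (ξ j))) := by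
        simp only [Finset.mul_sum]
        refine Finset.sum_congr rfl fun t _ => Finset.sum_congr rfl fun i _ => Finset.sum_congr rfl fun j _ => ?_
        ring
      rw [e2]
      linarith)
    have h2 : (∑ i, ∑ j, b i j * ((4 * C : ℝ) * (1 : Matrix (Fin n) (Fin n) ℂ) i j)).re = 4 * C * σ.trace.re := by
      rw [← herm_re b (fun i j => ((4 * C : ℝ) * (1 : Matrix (Fin n) (Fin n) ℂ) i j)) (fun i j => by
        simp [Matrix.one_apply, eq_comm]
        have h4 : conj (4 : ℂ) = 4 := Complex.conj_ofNat 4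
        split_ifs <;> simp [h4])]
      have : ∑ i, ∑ j, 1 / 2 * (b i j + conj (b j i)) * ((4 * C : ℝ) * (1 : Matrix (Fin n) (Fin n) ℂ) i j)
        = ((4 * C : ℝ) : ℂ) * σ.trace := by
        simp only [Matrix.one_apply, mul_ite, mul_one, mul_zero, Finset.sum_ite_eq, Finset.mem_univ, if_true]
        rw [Matrix.trace, Finset.mul_sum]
        refine Finset.sum_congr rfl fun i _ => ?_
        have : Matrix.diag σ i = (1 / 2 : ℂ) * (b i i + conj (b i i)) := rfl
        rw [this]
        ring
      rw [this, Complex.re_ofReal_mul]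
    have h3 : f x0 = (∑ t ∈ T, ∑ i, ∑ j, a t i j * (U t : Matrix (Fin n) (Fin n) ℂ) i j) -
      ∑ i, ∑ j, b i j * ((4 * C : ℝ) * (1 : Matrix (Fin n) (Fin n) ℂ) i j) := hab0
    rw [h3, Complex.sub_re, h2] at hc
    linarith
  obtain ⟨x, ⟨u, y, hu, hy, rfl⟩, hd⟩ := Metric.mem_closure_iff.1 hx0 ε hε
  rw [dist_comm, dist_pi_lt_iff hε] at hd
  refine ⟨u, y, hu, hy, fun t ht i j => ?_, fun i j => ?_⟩
  · have := hd (some ⟨t, ht⟩, i, j)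
    rw [dist_eq_norm] at this
    exact this
  · have := hd (none, i, j)
    rw [dist_eq_norm] at this
    exact this
end
end CSid

namespace CSid
open scoped ComplexOrder ComplexConjugate
open Filter Topology

section
variable {G : Type} [Group G] {Λ : Set G}

lemma perm_unitary {n : ℕ} {Q : Type} [Group Q] [DecidableEq Q] (e : Q ≃ Fin n) (s : Q) :
    (Matrix.of fun i j : Fin n => if e.symm i = s * e.symm j then (1 : ℂ) else 0) ∈
      unitary (Matrix (Fin n) (Fin n) ℂ) := by
  refine Matrix.mem_unitaryGroup_iff'.2 ?_
  ext i j
  have h1 : ∀ k i, e.symm k = s * e.symm i ↔ k = e (s * e.symm i) := fun k i => by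
    rw [Equiv.symm_apply_eq]
  simp [Matrix.mul_apply, h1, Matrix.one_apply, eq_comm]

lemma avg_kp {n : ℕ} {Q F : Type} [Group Q] [Fintype Q] [Group F] (q : F →* Q) (e : Q ≃ Fin n)
    (u : G → Fin n → Fin n → ℂ) (hu : KP fun p q : G × Fin n => u (p.1⁻¹ * q.1) p.2 q.2) :
    PD fun p : G × F => (((Fintype.card Q : ℝ)⁻¹ : ℝ) : ℂ) * ∑ x, u p.1 (e (q p.2 * x)) (e x) := by
  refine PD.smul (f := fun p : G × F => ∑ x, u p.1 (e (q p.2 * x)) (e x)) ?_ (by positivity)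
  have : (fun a b : G × F => ∑ x, u (a⁻¹ * b).1 (e (q (a⁻¹ * b).2 * x)) (e x)) =
      fun a b => ∑ z, u (a.1⁻¹ * b.1) (e ((q a.2)⁻¹ * z)) (e ((q b.2)⁻¹ * z)) := by
    funext a b
    refine Fintype.sum_equiv (Equiv.mulLeft (q b.2)) _ _ fun x => ?_
    simp [mul_assoc]
  unfold PD
  rw [this]
  exact KP.sum _ fun z _ => KP.comp hu (fun a : G × F => (a.1, e ((q a.2)⁻¹ * z)))

lemma avg_norm {Q : Type} [Fintype Q] [Nonempty Q] (f : Q → ℂ) (d : ℂ) {ε : ℝ}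
    (h : ∀ x, ‖f x - d‖ < ε) :
    ‖(((Fintype.card Q : ℝ)⁻¹ : ℝ) : ℂ) * ∑ x, f x - d‖ < ε := by
  have hc : (Fintype.card Q : ℂ) ≠ 0 := by simp
  have hc' : (0 : ℝ) < Fintype.card Q := by exact_mod_cast Fintype.card_pos
  have e1 : (((Fintype.card Q : ℝ)⁻¹ : ℝ) : ℂ) * ∑ x, f x - d =
      (((Fintype.card Q : ℝ)⁻¹ : ℝ) : ℂ) * ∑ x, (f x - d) := by
    simp [Finset.sum_sub_distrib, mul_sub]
  rw [e1, norm_mul, Complex.norm_real, Real.norm_of_nonneg (by positivity), inv_mul_lt_iff₀ hc']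
  refine (norm_sum_le _ _).trans_lt ?_
  refine (Finset.sum_lt_sum_of_nonempty Finset.univ_nonempty fun x _ => h x).trans_eq ?_
  simp

lemma step2fin [DecidableEq (FreeGroup ↥Λ)] {C : ℝ} (hC : 0 ≤ C) (hΛ : IsCompletelySidon Λ C)
    (T : Finset ↥Λ) (S : Finset (FreeGroup ↥Λ)) {ε : ℝ} (hε : 0 < ε) :
    ∃ (a : Fin 4 → G × FreeGroup ↥Λ → ℂ) (y : FreeGroup ↥Λ → ℂ), (∀ k, PD (a k)) ∧ PD y ∧
      (∀ t ∈ T, ∀ w, (FreeGroup.of t)⁻¹ * w ∈ S → ‖∑ k : Fin 4, Complex.I ^ (k : ℕ) * a k ((t : G), w)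
          - (if w = FreeGroup.of t then 1 else 0)‖ < ε) ∧
      ∀ w, (w ∈ S ∨ w = 1) → ‖∑ k, a k (1, w) + y w - ((4 * C : ℝ) : ℂ) * (if w = 1 then 1 else 0)‖ < ε := by
  classical
  obtain ⟨Q, _, _, q, hq⟩ := resfin (S.erase 1) (by simp)
  have hq' : ∀ w ∈ S, q w = 1 ↔ w = 1 := by
    intro w hw
    constructor
    · intro h
      by_contra h1
      exact hq w (Finset.mem_erase.2 ⟨h1, hw⟩) h
    · rintro rfl; simp
  let e := Fintype.equivFin Q
  let U : ↥Λ → unitary (Matrix (Fin (Fintype.card Q)) (Fin (Fintype.card Q)) ℂ) := fun t =>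
    ⟨_, perm_unitary e (q (FreeGroup.of t))⟩
  obtain ⟨u, y, hu, hy, hT, h1⟩ := step1 hC hΛ T U hε
  refine ⟨fun k p => (((Fintype.card Q : ℝ)⁻¹ : ℝ) : ℂ) * ∑ x, u k p.1 (e (q p.2 * x)) (e x),
    fun w => (((Fintype.card Q : ℝ)⁻¹ : ℝ) : ℂ) * ∑ x, y (e (q w * x)) (e x),
    fun k => avg_kp q e (u k) (hu k), ?_, fun t ht w hw => ?_, fun w hw => ?_⟩
  · have h2 : KP fun p q : G × Fin (Fintype.card Q) => y p.2 q.2 := hy.comp _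
    have := avg_kp (G := G) q e (fun _ => y) h2
    exact this.comp (MonoidHom.inr G _)
  · have e1 : ∑ k : Fin 4, Complex.I ^ (k : ℕ) * ((((Fintype.card Q : ℝ)⁻¹ : ℝ) : ℂ) * ∑ x, u k (t : G) (e (q w * x)) (e x))
      = (((Fintype.card Q : ℝ)⁻¹ : ℝ) : ℂ) * ∑ x, ∑ k : Fin 4, Complex.I ^ (k : ℕ) * u k (t : G) (e (q w * x)) (e x) := by
      rw [Finset.sum_comm, Finset.mul_sum]
      refine Finset.sum_congr rfl fun k _ => ?_
      rw [← Finset.mul_sum]; ring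
    rw [e1]
    refine avg_norm _ _ fun x => ?_
    convert hT t ht (e (q w * x)) (e x) using 3
    have := hq' _ hw
    rw [map_mul, map_inv, inv_mul_eq_one, inv_mul_eq_one] at this
    simp only [U, Matrix.of_apply, Equiv.symm_apply_apply, mul_left_inj]
    simp only [eq_comm] at this ⊢
    simp only [this]
  · have e1 : ∑ k : Fin 4, ((((Fintype.card Q : ℝ)⁻¹ : ℝ) : ℂ) * ∑ x, u k (1 : G) (e (q w * x)) (e x))
       + (((Fintype.card Q : ℝ)⁻¹ : ℝ) : ℂ) * ∑ x, y (e (q w * x)) (e x)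
      = (((Fintype.card Q : ℝ)⁻¹ : ℝ) : ℂ) * ∑ x, (∑ k : Fin 4, u k (1 : G) (e (q w * x)) (e x) + y (e (q w * x)) (e x)) := by
      rw [Finset.sum_add_distrib, Finset.sum_comm, mul_add, ← Finset.mul_sum]
    rw [e1]
    refine avg_norm _ _ fun x => ?_
    convert h1 (e (q w * x)) (e x) using 4
    have : q w = 1 ↔ w = 1 := by
      rcases hw with hw | rfl
      · exact hq' _ hw
      · simp
    simp [Matrix.one_apply, this]

lemma step2 [DecidableEq (FreeGroup ↥Λ)] {C : ℝ} (hC : 0 ≤ C) (hΛ : IsCompletelySidon Λ C) :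
    ∃ (a : Fin 4 → G × FreeGroup ↥Λ → ℂ), (∀ k, PD (a k)) ∧ (∀ k, Bdd (4 * C) (a k)) ∧
      ∀ (t : ↥Λ) w, ∑ k : Fin 4, Complex.I ^ (k : ℕ) * a k ((t : G), w)
          = (if w = FreeGroup.of t then 1 else 0) := by
  classical
  let I := Finset ↥Λ × Finset (FreeGroup ↥Λ) × ℕ
  have hex : ∀ i : I, _ := fun i => step2fin hC hΛ i.1 i.2.1 (ε := 1 / ((i.2.2 : ℝ) + 1)) (by positivity)
  choose a y ha hy hT h1 using hex
  let 𝓤 : Ultrafilter I := Ultrafilter.of atTop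
  have h𝓤 : (𝓤 : Filter I) ≤ atTop := Ultrafilter.of_le _
  have hεt : Tendsto (fun i : I => 1 / ((i.2.2 : ℝ) + 1)) 𝓤 (𝓝 0) := by
    have h2 : Tendsto (fun i : I => i.2.2) atTop atTop := by
      refine tendsto_atTop_atTop.2 fun b => ⟨(∅, ∅, b), fun i hi => hi.2.2⟩
    exact (tendsto_one_div_add_atTop_nhds_zero_nat.comp h2).mono_left h𝓤
  have hb : ∀ k p i, ‖a i k p‖ ≤ 4 * C + 1 := by
    intro k p i
    refine ((ha i k).norm_le p).trans ?_
    have h2 := h1 i 1 (Or.inr rfl)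
    have h3 : 1 / ((i.2.2 : ℝ) + 1) ≤ 1 := by
      rw [div_le_one (by positivity)]; simp
    have h4 := (Complex.re_le_norm _).trans (h2.le.trans h3)
    simp only [if_true, mul_one, Complex.sub_re, Complex.add_re, Complex.re_sum, Complex.ofReal_re] at h4
    have h5 : (a i k 1).re ≤ ∑ k, (a i k 1).re :=
      Finset.single_le_sum (f := fun k => (a i k 1).re) (fun k _ => (ha i k).one_nonneg.1) (Finset.mem_univ k)
    have h6 := (hy i).one_nonneg.1
    have h7 : ∑ k, (a i k 1).re = ∑ k, (a i k (1, 1)).re := rfl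
    linarith
  have hlim : ∀ k p, ∃ z, Tendsto (fun i => a i k p) 𝓤 (𝓝 z) := by
    intro k p
    obtain ⟨z, _, hz⟩ := (isCompact_closedBall (0 : ℂ) (4 * C + 1)).ultrafilter_le_nhds
      (𝓤.map fun i => a i k p) (by
        rw [Ultrafilter.coe_map, le_principal_iff, mem_map]
        exact Filter.univ_mem' fun i => by simpa using hb k p i)
    exact ⟨z, hz⟩
  choose A hA using hlim
  have hsq : ∀ (f : I → ℂ) (d : ℂ), (∀ᶠ i in (𝓤 : Filter I), ‖f i - d‖ < 1 / ((i.2.2 : ℝ) + 1)) →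
      Tendsto f 𝓤 (𝓝 d) := by
    intro f d h
    rw [tendsto_iff_norm_sub_tendsto_zero]
    exact squeeze_zero' (Eventually.of_forall fun _ => norm_nonneg _) (h.mono fun i hi => hi.le) hεt
  refine ⟨A, fun k => PD.lim (F := (𝓤 : Filter I)) (k := fun i => a i k) (fun p => hA k p) (Eventually.of_forall fun i => ha i k),
    fun k => ?_, fun t w => ?_⟩
  · have key : ∀ w, Tendsto (fun i => y i w + ∑ j ∈ Finset.univ.erase k, a i j (1, w)) 𝓤
        (𝓝 (((4 * C : ℝ) : ℂ) * (if w = 1 then 1 else 0) - A k (1, w))) := by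
      intro w
      have h2 := hsq (fun i => ∑ k, a i k (1, w) + y i w) _ (by
        filter_upwards [h𝓤 (mem_atTop (((∅, {w}, 0) : I)))] with i hi
        exact h1 i w (Or.inl (hi.2.1 (by simp))))
      refine (h2.sub (hA k (1, w))).congr fun i => ?_
      rw [← Finset.add_sum_erase _ _ (Finset.mem_univ k)]
      ring
    refine PD.lim (F := (𝓤 : Filter I)) key (Eventually.of_forall fun i => ?_)
    exact (hy i).add (PD.sum _ fun j _ => (ha i j).comp (MonoidHom.inr G _))
  · refine tendsto_nhds_unique (f := fun i => ∑ k : Fin 4, Complex.I ^ (k : ℕ) * a i k ((t : G), w)) (l := (𝓤 : Filter I))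
      (tendsto_finsetSum _ fun k _ => (hA k _).const_mul _) (hsq _ _ ?_)
    filter_upwards [h𝓤 (mem_atTop ((({t}, {(FreeGroup.of t)⁻¹ * w}, 0) : I)))] with i hi
    exact hT i t (hi.1 (by simp)) w (hi.2.1 (by simp))
end
end CSid

namespace CSid
open scoped ComplexOrder ComplexConjugate
open Filter Topology

lemma norm_one_word {α : Type} [DecidableEq α] (w : FreeGroup α) (h : w.norm = 1) :
    ∃ s, w = FreeGroup.of s ∨ w = (FreeGroup.of s)⁻¹ := by
  rw [FreeGroup.norm, List.length_eq_one_iff] at h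
  obtain ⟨⟨s, b⟩, h⟩ := h
  refine ⟨s, ?_⟩
  rw [← FreeGroup.mk_toWord (x := w), h]
  cases b
  · right; rfl
  · left; rfl

lemma of_ne_inv {α : Type} (s t : α) : FreeGroup.of s ≠ (FreeGroup.of t)⁻¹ := by
  intro h
  have := congrArg (FreeGroup.lift (fun _ : α => Multiplicative.ofAdd (1 : ℤ))) h
  simp only [map_inv, FreeGroup.lift_apply_of] at this
  have := congrArg Multiplicative.toAdd this
  simp at this

lemma circle_half (z : ℂ) (h : ‖z‖ ≤ 1) : ∃ u v : Circle, z = (1 / 2 : ℂ) * (u + v) := by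
  refine ⟨Circle.exp (z.arg + Real.arccos ‖z‖), Circle.exp (z.arg - Real.arccos ‖z‖), ?_⟩
  have h1 : Complex.cos (Real.arccos ‖z‖ : ℝ) = ‖z‖ := by
    rw [← Complex.ofReal_cos, Real.cos_arccos (by linarith [norm_nonneg z]) h]
  have h2 := Complex.norm_mul_exp_arg_mul_I z
  rw [Circle.coe_exp, Circle.coe_exp]
  push_cast
  rw [add_mul, sub_mul, sub_eq_add_neg, Complex.exp_add, Complex.exp_add]
  rw [Complex.cos] at h1
  rw [neg_mul] at h1
  linear_combination (-1 : ℂ) * h2 - Complex.exp (z.arg * Complex.I) * h1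

/-- the imaginary unit as an element of the circle -/
noncomputable def iC : Circle := ⟨Complex.I, by simp [Submonoid.unitSphere]⟩

lemma coe_iC : (iC : ℂ) = Complex.I := rfl

section
variable {G : Type} [Group G] {Λ : Set G}

/-- evaluation of words -/
noncomputable def bar : FreeGroup ↥Λ →* G := FreeGroup.lift (fun t : ↥Λ => (t : G))

/-- the graph subgroup -/
noncomputable def Gam : Subgroup (G × FreeGroup ↥Λ) :=
  (MonoidHom.fst G (FreeGroup ↥Λ)).eqLocus ((bar (Λ := Λ)).comp (MonoidHom.snd G (FreeGroup ↥Λ)))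

lemma mem_Gam (p : G × FreeGroup ↥Λ) : p ∈ Gam (Λ := Λ) ↔ p.1 = bar p.2 := Iff.rfl

open Classical in
/-- the multiplier -/
noncomputable def mult (θ : ℝ) (c : ↥Λ → Circle) (p : G × FreeGroup ↥Λ) : ℂ :=
  ((θ ^ p.2.norm : ℝ) : ℂ) * ((FreeGroup.lift c p.2 : Circle) : ℂ) * (if p ∈ Gam (Λ := Λ) then 1 else 0)

lemma mult_PD {θ : ℝ} (h0 : 0 ≤ θ) (h1 : θ ≤ 1) (c : ↥Λ → Circle) : PD (mult (Λ := Λ) θ c) := by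
  classical
  refine PD.mul (PD.mul ?_ ?_) (PD.ind _)
  · have := (PD.pow_norm (α := ↥Λ) θ h0 h1).comp (MonoidHom.snd G (FreeGroup ↥Λ))
    exact this
  · exact (PD.char (Circle.coeHom.comp (FreeGroup.lift c)) (fun x => Circle.norm_coe _)).comp
      (MonoidHom.snd G (FreeGroup ↥Λ))

lemma mult_one {θ : ℝ} (c : ↥Λ → Circle) : mult (Λ := Λ) θ c 1 = 1 := by
  classical
  simp [mult, one_mem]

lemma mult_norm {θ : ℝ} (h0 : 0 ≤ θ) (h1 : θ ≤ 1) (c : ↥Λ → Circle) (p : G × FreeGroup ↥Λ) :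
    ‖mult θ c p‖ ≤ 1 := by
  simpa [mult_one] using (mult_PD h0 h1 c).norm_le p

lemma mult_Bdd [DecidableEq (FreeGroup ↥Λ)] {θ : ℝ} (h0 : 0 ≤ θ) (h1 : θ ≤ 1) (c : ↥Λ → Circle)
    {a : G × FreeGroup ↥Λ → ℂ} {C : ℝ} (ha : Bdd C a) : Bdd C fun p => mult θ c p * a p := by
  have := ((mult_PD h0 h1 c).comp (MonoidHom.inr G (FreeGroup ↥Λ))).mul ha
  unfold Bdd
  convert this using 2 with w
  by_cases h : w = 1
  · subst h
    have : mult (Λ := Λ) θ c (1, 1) = 1 := mult_one c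
    simp [this]
  · simp [h]

/-- the coefficients -/
noncomputable def cjk (ζ : ↥Λ → Circle) (j k : Fin 4) : ↥Λ → Circle :=
  fun t => ζ t * iC ^ (j : ℕ) * (iC ^ (k : ℕ))⁻¹

lemma coe_cjk (ζ : ↥Λ → Circle) (j k : Fin 4) (t : ↥Λ) : (cjk ζ j k t : ℂ) =
    ζ t * Complex.I ^ (j : ℕ) * conj (Complex.I ^ (k : ℕ)) := by
  rw [cjk, Circle.coe_mul, Circle.coe_mul, Circle.coe_inv_eq_conj, Circle.coe_pow, Circle.coe_pow, coe_iC]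

set_option maxHeartbeats 2000000 in
lemma theta [DecidableEq (FreeGroup ↥Λ)] (hΛ1 : (1 : G) ∉ Λ) {C : ℝ} (hC : 0 ≤ C)
    {a : Fin 4 → G × FreeGroup ↥Λ → ℂ} (ha : ∀ k, PD (a k)) (hb : ∀ k, Bdd C (a k))
    (hI : ∀ (t : ↥Λ) w, ∑ k : Fin 4, Complex.I ^ (k : ℕ) * a k ((t : G), w)
          = (if w = FreeGroup.of t then 1 else 0))
    (ζ : ↥Λ → Circle) {θ : ℝ} (h0 : 0 ≤ θ) (h1 : θ ≤ 1) :
    ∃ Θ : G → ℂ, PD Θ ∧ (∀ g, ‖Θ g‖ ≤ 16 * (2 * C) ^ 2) ∧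
      ∀ t t' : ↥Λ, (t' : G) = (t : G)⁻¹ → ‖Θ t - θ * (ζ t + conj (ζ t' : ℂ))‖ ≤ θ ^ 2 * (16 * (2 * C) ^ 2) := by
  classical
  let H : Fin 4 → Fin 4 → G → FreeGroup ↥Λ → ℂ := fun j k g w =>
    mult θ (cjk ζ j k) (g, w) * a j (g, w) * conj (a k (g, w))
  have hps := fun j k g => pair_summable (ha j) (ha k) hC (hb j) (hb k) g
  have hHn : ∀ j k g w, ‖H j k g w‖ ≤ ‖a j (g, w)‖ * ‖a k (g, w)‖ := by
    intro j k g w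
    simp only [H, norm_mul, RCLike.norm_conj]
    have := mult_norm h0 h1 (cjk ζ j k) (g, w)
    have h2 : 0 ≤ ‖a j (g, w)‖ * ‖a k (g, w)‖ := by positivity
    nlinarith
  have hHs : ∀ j k g, Summable (H j k g) := fun j k g =>
    Summable.of_norm_bounded (hps j k g).1 (hHn j k g)
  let Θ : G → ℂ := fun g => ∑ j, ∑ k, ∑' w, H j k g w
  have hΘ : PD Θ := PD.sum _ fun j _ => PD.sum _ fun k _ =>
    pairing ((mult_PD h0 h1 (cjk ζ j k)).mul (ha j)) (ha k) hC (mult_Bdd h0 h1 _ (hb j)) (hb k)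
  let N : G → FreeGroup ↥Λ → ℝ := fun g w => ∑ j, ∑ k, ‖a j (g, w)‖ * ‖a k (g, w)‖
  have hNs : ∀ g, Summable (N g) := fun g =>
    summable_sum fun j _ => summable_sum fun k _ => (hps j k g).1
  have hNb : ∀ g, ∑' w, N g w ≤ 16 * (2 * C) ^ 2 := by
    intro g
    have e1 : ∑' w, N g w = ∑ j, ∑ k, ∑' w, ‖a j (g, w)‖ * ‖a k (g, w)‖ := by
      simp only [N]
      rw [Summable.tsum_finsetSum (fun j _ => summable_sum fun k _ => (hps j k g).1)]
      refine Finset.sum_congr rfl fun j _ => ?_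
      rw [Summable.tsum_finsetSum (fun k _ => (hps j k g).1)]
    rw [e1]
    calc _ ≤ ∑ j : Fin 4, ∑ k : Fin 4, (2 * C) ^ 2 :=
          Finset.sum_le_sum fun j _ => Finset.sum_le_sum fun k _ => (hps j k g).2
      _ = _ := by simp; ring
  have hHsum : ∀ g, HasSum (fun w => ∑ j, ∑ k, H j k g w) (Θ g) := fun g =>
    hasSum_sum fun j _ => hasSum_sum fun k _ => (hHs j k g).hasSum
  refine ⟨Θ, hΘ, fun g => ?_, fun t t' htt => ?_⟩
  · rw [← (hHsum g).tsum_eq]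
    refine (tsum_of_norm_bounded (hNs g).hasSum fun w => ?_).trans (hNb g)
    exact (norm_sum_le _ _).trans (Finset.sum_le_sum fun j _ =>
      (norm_sum_le _ _).trans (Finset.sum_le_sum fun k _ => hHn j k g w))
  · have hb1 : bar (FreeGroup.of t) = (t : G) := by simp [bar]
    have hb2 : bar (FreeGroup.of t')⁻¹ = (t : G) := by simp [bar, htt]
    -- value at the first word
    have v1 : ∑ j, ∑ k, H j k t (FreeGroup.of t) = θ * ζ t := by
      have e1 : ∀ j k, H j k t (FreeGroup.of t) = θ * ζ t * ((Complex.I ^ (j : ℕ) * a j (t, FreeGroup.of t)) *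
          conj (Complex.I ^ (k : ℕ) * a k (t, FreeGroup.of t))) := by
        intro j k
        simp only [H, mult, mem_Gam, hb1, if_true, FreeGroup.norm_of, pow_one, FreeGroup.lift_apply_of, coe_cjk, map_mul]
        ring
      simp only [e1, ← Finset.mul_sum, ← Finset.sum_mul]
      rw [← map_sum, hI]
      simp
    have v2 : ∑ j, ∑ k, H j k t (FreeGroup.of t')⁻¹ = θ * conj (ζ t' : ℂ) := by
      have e0 : ∀ j, a j ((t : G), (FreeGroup.of t')⁻¹) = conj (a j ((t' : G), FreeGroup.of t')) := by
        intro j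
        rw [← (ha j).herm ((t : G), (FreeGroup.of t')⁻¹)]
        simp [htt]
      have e1 : ∀ j k, H j k t (FreeGroup.of t')⁻¹ = θ * conj (ζ t' : ℂ) * (conj (Complex.I ^ (j : ℕ) * a j (t', FreeGroup.of t')) *
          (Complex.I ^ (k : ℕ) * a k (t', FreeGroup.of t'))) := by
        intro j k
        simp only [H, mult, mem_Gam, hb2, if_true, FreeGroup.norm_inv_eq, FreeGroup.norm_of, pow_one, map_inv,
          FreeGroup.lift_apply_of, Circle.coe_inv_eq_conj, coe_cjk, map_mul, e0, Complex.conj_conj]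
        ring
      simp only [e1, ← Finset.mul_sum, ← Finset.sum_mul]
      rw [← map_sum, hI]
      simp
    have hR : HasSum (fun w => ∑ j, ∑ k, H j k t w - (if w = FreeGroup.of t then (θ * ζ t : ℂ) else 0)
        - (if w = (FreeGroup.of t')⁻¹ then (θ * conj (ζ t' : ℂ) : ℂ) else 0))
        (Θ t - θ * ζ t - θ * conj (ζ t' : ℂ)) :=
      ((hHsum t).sub (hasSum_ite_eq _ _)).sub (hasSum_ite_eq _ _)
    have hne := of_ne_inv t t'
    rw [mul_add, ← sub_sub, ← hR.tsum_eq]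
    refine (tsum_of_norm_bounded ((hNs t).hasSum.mul_left (θ ^ 2)) fun w => ?_).trans
      (mul_le_mul_of_nonneg_left (hNb t) (by positivity))
    have hN0 : 0 ≤ θ ^ 2 * N t w := mul_nonneg (by positivity)
      (Finset.sum_nonneg fun j _ => Finset.sum_nonneg fun k _ => by positivity)
    by_cases hw1 : w = FreeGroup.of t
    · subst hw1
      rw [if_pos rfl, if_neg hne, v1]
      simpa using hN0
    by_cases hw2 : w = (FreeGroup.of t')⁻¹
    · subst hw2
      rw [if_neg (Ne.symm hne), if_pos rfl, v2]
      simpa using hN0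
    rw [if_neg hw1, if_neg hw2, sub_zero, sub_zero]
    by_cases hbar : (t : G) = bar w
    swap
    · have : ∀ j k, H j k t w = 0 := by
        intro j k
        simp [H, mult, mem_Gam, hbar]
      simpa [this] using hN0
    have hnorm : 2 ≤ w.norm := by
      by_contra! hlt
      have : w.norm = 0 ∨ w.norm = 1 := by omega
      rcases this with h | h
      · rw [FreeGroup.norm_eq_zero] at h
        subst h
        rw [map_one] at hbar
        exact hΛ1 (hbar ▸ t.2)
      · obtain ⟨s, rfl | rfl⟩ := norm_one_word w h
        · have : (t : G) = s := by simpa [bar] using hbar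
          exact hw1 (by rw [Subtype.ext this])
        · have : (t : G) = (s : G)⁻¹ := by simpa [bar] using hbar
          refine hw2 ?_
          rw [Subtype.ext (a1 := t') (a2 := s) (by rw [htt, this, inv_inv])]
    have hHn2 : ∀ j k, ‖H j k t w‖ ≤ θ ^ 2 * (‖a j (t, w)‖ * ‖a k (t, w)‖) := by
      intro j k
      have : ‖mult θ (cjk ζ j k) ((t : G), w)‖ ≤ θ ^ 2 := by
        have h3 : θ ^ w.norm ≤ θ ^ 2 := pow_le_pow_of_le_one h0 h1 hnorm
        have h4 : ‖((FreeGroup.lift (cjk ζ j k) w : Circle) : ℂ)‖ = 1 := Circle.norm_coe _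
        simpa [mult, mem_Gam, hbar.symm, abs_of_nonneg h0, h4] using h3
      simp only [H, norm_mul, RCLike.norm_conj]
      rw [mul_assoc]
      gcongr
    simp only [N, Finset.mul_sum]
    exact (norm_sum_le _ _).trans (Finset.sum_le_sum fun j _ =>
      (norm_sum_le _ _).trans (Finset.sum_le_sum fun k _ => hHn2 j k))

lemma approx (hΛ1 : (1 : G) ∉ Λ) {C : ℝ} (hC : 0 ≤ C) (hΛ : IsCompletelySidon Λ C) (inv : ↥Λ → ↥Λ)
    (hinv : ∀ t, (inv t : G) = (t : G)⁻¹) :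
    ∃ K : ℝ, ∀ φ : ↥Λ → ℂ, (∀ t, φ (inv t) = conj (φ t)) → (∀ t, ‖φ t‖ ≤ 1) →
      ∃ Θ : G → ℂ, PD Θ ∧ (∀ g, ‖Θ g‖ ≤ K) ∧ ∀ t : ↥Λ, ‖Θ t - φ t‖ ≤ 1 / 2 := by
  classical
  obtain ⟨a, ha, hb, hI⟩ := step2 hC hΛ
  set B : ℝ := 16 * (2 * (4 * C)) ^ 2 with hB
  have hB0 : 0 ≤ B := by positivity
  let θ : ℝ := 1 / (B + 1)
  have hθ0 : 0 < θ := by positivity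
  have hθ1 : θ ≤ 1 := by
    simp only [θ]; rw [div_le_one (by positivity)]; linarith
  have hθB : θ * B ≤ 1 := by
    simp only [θ]; rw [div_mul_eq_mul_div, one_mul, div_le_one (by positivity)]; linarith
  refine ⟨1 / (2 * θ) * B, fun φ hφ hφ1 => ?_⟩
  choose u v huv using fun t => circle_half (φ t) (hφ1 t)
  obtain ⟨Θ, h1, h2, h3⟩ := theta hΛ1 (by positivity) ha hb hI u hθ0.le hθ1
  obtain ⟨Θ', h1', h2', h3'⟩ := theta hΛ1 (by positivity) ha hb hI v hθ0.le hθ1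
  have hp : 0 ≤ 1 / (4 * θ) := by positivity
  refine ⟨fun g => ((1 / (4 * θ) : ℝ) : ℂ) * (Θ g + Θ' g), (h1.add h1').smul hp, fun g => ?_, fun t => ?_⟩
  · rw [norm_mul, Complex.norm_real, Real.norm_of_nonneg hp]
    calc _ ≤ 1 / (4 * θ) * (B + B) := by
          gcongr
          exact (norm_add_le _ _).trans (add_le_add (h2 g) (h2' g))
      _ = _ := by field_simp; ring
  · have g1 := h3 t (inv t) (hinv t)
    have g2 := h3' t (inv t) (hinv t)
    have hθc : (θ : ℂ) ≠ 0 := by exact_mod_cast hθ0.ne'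
    have e1 : ((1 / (4 * θ) : ℝ) : ℂ) * (Θ t + Θ' t) - φ t =
        ((1 / (4 * θ) : ℝ) : ℂ) * ((Θ t - θ * (u t + conj (u (inv t) : ℂ))) +
          (Θ' t - θ * (v t + conj (v (inv t) : ℂ)))) := by
      have h5 := huv t
      have h6 := huv (inv t)
      rw [hφ] at h6
      have h7 : φ t = (1 / 2 : ℂ) * (conj (u (inv t) : ℂ) + conj (v (inv t) : ℂ)) := by
        have := congrArg conj h6
        rw [Complex.conj_conj] at this
        rw [this, map_mul, map_add]
        congr 1
        simp [Complex.conj_ofNat]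
      push_cast
      field_simp
      linear_combination (-2 * θ : ℂ) * h5 - 2 * θ * h7
    rw [e1, norm_mul, Complex.norm_real, Real.norm_of_nonneg hp]
    calc _ ≤ 1 / (4 * θ) * (θ ^ 2 * B + θ ^ 2 * B) := by
          gcongr
          exact (norm_add_le _ _).trans (add_le_add g1 g2)
      _ = θ * B / 2 := by field_simp; ring
      _ ≤ _ := by linarith

lemma iterate (inv : ↥Λ → ↥Λ) (hinv : ∀ t, (inv t : G) = (t : G)⁻¹) {K : ℝ}
    (hK : ∀ φ : ↥Λ → ℂ, (∀ t, φ (inv t) = conj (φ t)) → (∀ t, ‖φ t‖ ≤ 1) →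
      ∃ Θ : G → ℂ, PD Θ ∧ (∀ g, ‖Θ g‖ ≤ K) ∧ ∀ t : ↥Λ, ‖Θ t - φ t‖ ≤ 1 / 2)
    (φ : ↥Λ → ℂ) (hφ : ∀ t, φ (inv t) = conj (φ t)) (hφ1 : ∀ t, ‖φ t‖ ≤ 1) :
    ∃ Θ : G → ℂ, PD Θ ∧ ∀ t : ↥Λ, Θ t = φ t := by
  let X := {φ : ↥Λ → ℂ // (∀ t, φ (inv t) = conj (φ t)) ∧ (∀ t, ‖φ t‖ ≤ 1)}
  have hX : ∀ x : X, _ := fun x => hK x.1 x.2.1 x.2.2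
  choose Θ h1 h2 h3 using hX
  let next : X → X := fun x => ⟨fun t => 2 * (x.1 t - Θ x t), fun t => by
      change 2 * (x.1 (inv t) - Θ x (inv t)) = conj (2 * (x.1 t - Θ x t))
      rw [x.2.1, hinv, map_mul, map_sub, Complex.conj_ofNat, show Θ x (t : G)⁻¹ = (starRingEnd ℂ) (Θ x t) by rw [← (h1 x).herm (t : G), Complex.conj_conj]], fun t => by
      rw [norm_mul, norm_sub_rev]
      have := h3 x t
      simp only [Complex.norm_ofNat]
      linarith⟩
  let s : ℕ → X := fun n => next^[n] ⟨φ, hφ, hφ1⟩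
  have hs0 : (s 0).1 = φ := rfl
  have hs : ∀ n t, (s (n + 1)).1 t = 2 * ((s n).1 t - Θ (s n) t) := by
    intro n t
    simp only [s, Function.iterate_succ_apply']
    rfl
  have hsum : ∀ g, Summable fun n => (((1 / 2 : ℝ) ^ n : ℝ) : ℂ) * Θ (s n) g := by
    intro g
    refine Summable.of_norm_bounded (g := fun n => (1 / 2 : ℝ) ^ n * K)
      ((summable_geometric_of_lt_one (by norm_num) (by norm_num)).mul_right K) fun n => ?_
    rw [norm_mul, Complex.norm_real, Real.norm_of_nonneg (by positivity)]
    gcongr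
    exact h2 _ g
  refine ⟨fun g => ∑' n, (((1 / 2 : ℝ) ^ n : ℝ) : ℂ) * Θ (s n) g, ?_, fun t => ?_⟩
  · refine PD.lim (F := atTop) (k := fun N g => ∑ n ∈ Finset.range N, (((1 / 2 : ℝ) ^ n : ℝ) : ℂ) * Θ (s n) g)
      (fun g => (hsum g).hasSum.tendsto_sum_nat) (Eventually.of_forall fun N => ?_)
    exact PD.sum _ fun n _ => (h1 (s n)).smul (by positivity)
  · have hp : ∀ N, ∑ n ∈ Finset.range N, (((1 / 2 : ℝ) ^ n : ℝ) : ℂ) * Θ (s n) t =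
        φ t - (((1 / 2 : ℝ) ^ N : ℝ) : ℂ) * (s N).1 t := by
      intro N
      induction N with
      | zero => simp [hs0]
      | succ N ih =>
        rw [Finset.sum_range_succ, ih, hs]
        push_cast
        ring
    refine tendsto_nhds_unique (hsum t).hasSum.tendsto_sum_nat ?_
    simp only [hp]
    have : Tendsto (fun N => (((1 / 2 : ℝ) ^ N : ℝ) : ℂ) * (s N).1 t) atTop (𝓝 0) := by
      refine squeeze_zero_norm (a := fun N => (1 / 2 : ℝ) ^ N) (fun N => ?_)
        (tendsto_pow_atTop_nhds_zero_of_lt_one (by norm_num) (by norm_num))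
      rw [norm_mul, Complex.norm_real, Real.norm_of_nonneg (by positivity)]
      have := (s N).2.2 t
      have h5 : (0 : ℝ) ≤ (1 / 2) ^ N := by positivity
      nlinarith
    simpa using tendsto_const_nhds.sub this
end
end CSid

theorem completelySidon_fatouZygmund_scalar {G : Type} [Group G] (Λ : Set G)
    (hΛ1 : (1 : G) ∉ Λ) (hsym : Λ⁻¹ = Λ) (C : ℝ) (hΛ : IsCompletelySidon Λ C)
    (φ : ↥Λ → ℂ) (M : ℝ) (hbdd : ∀ t, ‖φ t‖ ≤ M)
    (hherm : ∀ (t : ↥Λ) (h : ((t : G))⁻¹ ∈ Λ), φ ⟨(t : G)⁻¹, h⟩ = starRingEnd ℂ (φ t)) :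
    ∃ φt : G → ℂ, (∀ t : ↥Λ, φt t = φ t) ∧ IsPosDefFn φt := by
  have hΛ' : IsCompletelySidon Λ |C| := by
    intro N a D hD h K _ _ _ u
    exact (hΛ N a D hD h K u).trans (mul_le_mul_of_nonneg_right (le_abs_self C) hD)
  have hi : ∀ t : ↥Λ, (t : G)⁻¹ ∈ Λ := fun t => by
    exact Set.mem_inv.1 (hsym.symm.subset t.2)
  let inv : ↥Λ → ↥Λ := fun t => ⟨(t : G)⁻¹, hi t⟩
  obtain ⟨K, hK⟩ := CSid.approx hΛ1 (abs_nonneg C) hΛ' inv (fun _ => rfl)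
  have hM : (0 : ℝ) < |M| + 1 := by positivity
  obtain ⟨Θ, h1, h2⟩ := CSid.iterate inv (fun _ => rfl) hK
    (fun t => (((|M| + 1)⁻¹ : ℝ) : ℂ) * φ t) (fun t => by
      rw [map_mul, Complex.conj_ofReal, hherm]) (fun t => by
      rw [norm_mul, Complex.norm_real, Real.norm_of_nonneg (by positivity), inv_mul_le_iff₀ hM]
      have := hbdd t
      have := le_abs_self M
      linarith)
  refine ⟨fun g => ((|M| + 1 : ℝ) : ℂ) * Θ g, fun t => ?_, fun n t => (h1.smul hM.le).kp t⟩
  have hMc : ((|M| + 1 : ℝ) : ℂ) ≠ 0 := by exact_mod_cast hM.ne'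
  change ((|M| + 1 : ℝ) : ℂ) * Θ t = φ t
  rw [h2, Complex.ofReal_inv, mul_inv_cancel_left₀ hMc]
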